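/- arXiv:0909.5289 — 2 statements merged into one kernel-verified Lean document; each statement's English description precedes it below -/
import Mathlib

section
/- (Corollary 1; Ramachandran's theorem) Let X be a random variable (p = 1 case of the Lévy–Khintchine setup) and let β ∈ [0,∞). Then E(|X|^β) < ∞ if and only if ∫_ℝ |x|^β dν₁(x) < ∞. -/
open MeasureTheory ProbabilityTheory
open Filter Topology
open scoped NNReal ENNReal Nat

/-- The `n`-fold additive convolution of a measure with itself. -/
noncomputable def convPow (ν : Measure ℝ) : ℕ → Measure ℝ
  | 0 => Measure.dirac 0
  | n + 1 => convPow ν n ∗ ν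

instance isFiniteMeasure_convPow (ν : Measure ℝ) [IsFiniteMeasure ν] (n : ℕ) :
    IsFiniteMeasure (convPow ν n) := by
  induction n with
  | zero => unfold convPow; infer_instance
  | succ n ih => unfold convPow; infer_instance

theorem charFun_convPow (ν : Measure ℝ) [IsFiniteMeasure ν] (n : ℕ) (t : ℝ) :
    charFun (convPow ν n) t = charFun ν t ^ n := by
  induction n with
  | zero => simp [convPow, charFun_dirac]
  | succ n ih => rw [convPow, charFun_conv, ih, pow_succ]

theorem convPow_univ (ν : Measure ℝ) [IsFiniteMeasure ν] (n : ℕ) :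
    convPow ν n Set.univ = ν Set.univ ^ n := by
  induction n with
  | zero => simp [convPow]
  | succ n ih =>
    rw [convPow, ← lintegral_one, Measure.lintegral_conv measurable_const]
    simp [ih, pow_succ, mul_comm]

theorem lintegral_conv_le_mul {g : ℝ → ℝ≥0∞} (hg : Measurable g)
    (hadd : ∀ x y, g (x + y) ≤ g x * g y) (μ ν : Measure ℝ) [SFinite ν] :
    ∫⁻ x, g x ∂(μ ∗ ν) ≤ (∫⁻ x, g x ∂μ) * ∫⁻ x, g x ∂ν := by
  rw [Measure.lintegral_conv hg, ← lintegral_mul_const _ hg]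
  refine lintegral_mono fun x => ?_
  rw [← lintegral_const_mul _ hg]
  exact lintegral_mono fun y => hadd x y

theorem lintegral_convPow_le {g : ℝ → ℝ≥0∞} (hg : Measurable g) (h0 : g 0 ≤ 1)
    (hadd : ∀ x y, g (x + y) ≤ g x * g y) (ν : Measure ℝ) [IsFiniteMeasure ν] (n : ℕ) :
    ∫⁻ x, g x ∂(convPow ν n) ≤ (∫⁻ x, g x ∂ν) ^ n := by
  induction n with
  | zero => simpa [convPow, lintegral_dirac' _ hg] using h0
  | succ n ih =>
    rw [convPow, pow_succ]
    exact (lintegral_conv_le_mul hg hadd _ _).trans (by gcongr)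

/-- The compound Poisson law with finite jump measure `ν`. -/
noncomputable def compoundPoisson (ν : Measure ℝ) : Measure ℝ :=
  Measure.sum fun n : ℕ =>
    ENNReal.ofReal (Real.exp (-ν.real Set.univ) / n !) • convPow ν n

theorem tsum_ofReal_exp_neg_mul_pow (c l : ℝ) (hl : 0 ≤ l) :
    ∑' n : ℕ, ENNReal.ofReal (Real.exp (-c) / n !) * ENNReal.ofReal l ^ n =
      ENNReal.ofReal (Real.exp (l - c)) := by
  have h := (NormedSpace.expSeries_div_hasSum_exp l).mul_left (Real.exp (-c))
  rw [← Real.exp_eq_exp_ℝ, ← Real.exp_add, neg_add_eq_sub] at h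
  rw [← h.tsum_eq, ENNReal.ofReal_tsum_of_nonneg (fun n => by positivity) h.summable]
  refine tsum_congr fun n => ?_
  rw [← ENNReal.ofReal_pow hl, ← ENNReal.ofReal_mul (by positivity)]
  congr 1
  ring

instance isProbabilityMeasure_compoundPoisson (ν : Measure ℝ) [IsFiniteMeasure ν] :
    IsProbabilityMeasure (compoundPoisson ν) := by
  constructor
  rw [compoundPoisson, Measure.sum_apply _ MeasurableSet.univ]
  simp only [Measure.smul_apply, smul_eq_mul, convPow_univ]
  have h := tsum_ofReal_exp_neg_mul_pow (ν.real Set.univ) (ν.real Set.univ) measureReal_nonneg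
  simpa using h

theorem lintegral_compoundPoisson_le {g : ℝ → ℝ≥0∞} (hg : Measurable g) (h0 : g 0 ≤ 1)
    (hadd : ∀ x y, g (x + y) ≤ g x * g y) (ν : Measure ℝ) [IsFiniteMeasure ν] {l : ℝ}
    (hl : 0 ≤ l) (hgl : ∫⁻ x, g x ∂ν ≤ ENNReal.ofReal l) :
    ∫⁻ x, g x ∂(compoundPoisson ν) ≤ ENNReal.ofReal (Real.exp (l - ν.real Set.univ)) := by
  rw [compoundPoisson, lintegral_sum_measure, ← tsum_ofReal_exp_neg_mul_pow _ _ hl]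
  refine ENNReal.tsum_le_tsum fun n => ?_
  rw [lintegral_smul_measure, smul_eq_mul]
  gcongr
  exact (lintegral_convPow_le hg h0 hadd ν n).trans (by gcongr)

theorem smul_le_compoundPoisson (ν : Measure ℝ) [IsFiniteMeasure ν] :
    ENNReal.ofReal (Real.exp (-ν.real Set.univ)) • ν ≤ compoundPoisson ν := by
  have h := Measure.le_sum (fun n : ℕ =>
    ENNReal.ofReal (Real.exp (-ν.real Set.univ) / n !) • convPow ν n) 1
  simpa [convPow, compoundPoisson] using h

theorem charFun_compoundPoisson (ν : Measure ℝ) [IsFiniteMeasure ν] (t : ℝ) :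
    charFun (compoundPoisson ν) t = Complex.exp (charFun ν t - ν.real Set.univ) := by
  have hint : Integrable (fun x : ℝ => Complex.exp (t * x * Complex.I)) (compoundPoisson ν) := by
    refine Integrable.of_bound (by fun_prop) 1 (ae_of_all _ fun x => ?_)
    rw [← Complex.ofReal_mul, Complex.norm_exp_ofReal_mul_I]
  rw [charFun_apply_real]
  have h := hasSum_integral_measure (f := fun x : ℝ => Complex.exp (t * x * Complex.I)) hint
  refine h.unique ?_
  have h2 := (NormedSpace.expSeries_div_hasSum_exp (charFun ν t)).mul_left
    (Complex.exp (-(ν.real Set.univ : ℂ)))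
  rw [← Complex.exp_eq_exp_ℂ, ← Complex.exp_add, neg_add_eq_sub] at h2
  refine (congrArg (HasSum · _) (funext fun n => ?_)).mpr h2
  rw [integral_smul_measure, ← charFun_apply_real, charFun_convPow,
    ENNReal.toReal_ofReal (by positivity), Complex.real_smul]
  push_cast
  ring

theorem one_add_abs_rpow_le_exp (β x : ℝ) :
    (1 + |x|) ^ β ≤ (⌈β⌉₊ ! * Real.exp 1) * Real.exp |x| := by
  have h1 : (1 + |x|) ^ β ≤ (1 + |x|) ^ ⌈β⌉₊ := by
    rw [← Real.rpow_natCast]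
    exact Real.rpow_le_rpow_of_exponent_le (by linarith [abs_nonneg x]) (Nat.le_ceil β)
  have h2 := Real.pow_div_factorial_le_exp (x := 1 + |x|) (by positivity) ⌈β⌉₊
  rw [div_le_iff₀ (by positivity), Real.exp_add] at h2
  linarith

theorem one_add_abs_rpow_add_le {β : ℝ} (hβ : 0 ≤ β) (x y : ℝ) :
    (1 + |x + y|) ^ β ≤ (1 + |x|) ^ β * (1 + |y|) ^ β := by
  rw [← Real.mul_rpow (by positivity) (by positivity)]
  refine Real.rpow_le_rpow (by positivity) ?_ hβ
  nlinarith [abs_add_le x y, mul_nonneg (abs_nonneg x) (abs_nonneg y)]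

theorem lintegral_abs_rpow_lt_top_of_tendsto_conv_compoundPoisson
    {ν : Measure ℝ} [IsFiniteMeasure ν] {γ : ℕ → Measure ℝ} [∀ n, SFinite (γ n)] {B : ℝ≥0∞}
    (hB : B ≠ ⊤) (hγ : ∀ n, ∫⁻ x, ENNReal.ofReal (Real.exp |x|) ∂(γ n) ≤ B)
    {μ : ProbabilityMeasure ℝ} {μs : ℕ → ProbabilityMeasure ℝ}
    (hμs : ∀ n, (μs n : Measure ℝ) = γ n ∗ compoundPoisson ν)
    (hlim : Tendsto μs atTop (𝓝 μ)) {τ : ℝ} (hτ : 0 < τ) (hν : ∀ᵐ x ∂ν, τ ≤ |x|)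
    {β : ℝ} (hβ : 0 ≤ β) (hint : ∫⁻ x, ENNReal.ofReal (|x| ^ β) ∂ν < ⊤) :
    ∫⁻ x, ENNReal.ofReal (|x| ^ β) ∂(μ : Measure ℝ) < ⊤ := by
  set g : ℝ → ℝ≥0∞ := fun x => ENNReal.ofReal ((1 + |x|) ^ β) with hg_def
  have hg : Measurable g := by fun_prop
  have hg0 : g 0 ≤ 1 := by simp [hg_def]
  have hadd : ∀ x y, g (x + y) ≤ g x * g y := fun x y => by
    rw [hg_def, ← ENNReal.ofReal_mul (by positivity)]
    exact ENNReal.ofReal_le_ofReal (one_add_abs_rpow_add_le hβ x y)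
  have hgν : ∫⁻ x, g x ∂ν ≠ ⊤ := by
    have hle : ∫⁻ x, g x ∂ν ≤
        ENNReal.ofReal ((1 + 1 / τ) ^ β) * ∫⁻ x, ENNReal.ofReal (|x| ^ β) ∂ν := by
      rw [← lintegral_const_mul _ (by fun_prop)]
      refine lintegral_mono_ae (hν.mono fun x hx => ?_)
      rw [← ENNReal.ofReal_mul (by positivity), ← Real.mul_rpow (by positivity) (by positivity)]
      refine ENNReal.ofReal_le_ofReal (Real.rpow_le_rpow (by positivity) ?_ hβ)
      have : 1 ≤ 1 / τ * |x| := by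
        rw [one_div, ← div_eq_inv_mul, one_le_div hτ]
        exact hx
      linarith
    exact (hle.trans_lt (ENNReal.mul_lt_top ENNReal.ofReal_lt_top hint)).ne
  have hgπ : ∫⁻ x, g x ∂(compoundPoisson ν) < ⊤ :=
    (lintegral_compoundPoisson_le hg hg0 hadd ν ENNReal.toReal_nonneg
      (ENNReal.ofReal_toReal hgν).ge).trans_lt ENNReal.ofReal_lt_top
  have hgγ : ∀ n, ∫⁻ x, g x ∂(γ n) ≤ ENNReal.ofReal (⌈β⌉₊ ! * Real.exp 1) * B := fun n => by
    refine le_trans ?_ (mul_le_mul_right (hγ n) _)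
    rw [← lintegral_const_mul _ (by fun_prop)]
    refine lintegral_mono fun x => ?_
    rw [← ENNReal.ofReal_mul (by positivity)]
    exact ENNReal.ofReal_le_ofReal (one_add_abs_rpow_le_exp β x)
  have hbound : ∀ n, ∫⁻ x, ENNReal.ofReal (|x| ^ β) ∂(μs n : Measure ℝ) ≤
      ENNReal.ofReal (⌈β⌉₊ ! * Real.exp 1) * B * ∫⁻ x, g x ∂(compoundPoisson ν) := fun n => by
    calc ∫⁻ x, ENNReal.ofReal (|x| ^ β) ∂(μs n : Measure ℝ)
        ≤ ∫⁻ x, g x ∂(γ n ∗ compoundPoisson ν) := by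
          rw [hμs]
          refine lintegral_mono fun x => ENNReal.ofReal_le_ofReal ?_
          exact Real.rpow_le_rpow (abs_nonneg x) (by linarith) hβ
      _ ≤ _ := lintegral_conv_le_mul hg hadd _ _
      _ ≤ _ := by gcongr; exact hgγ n
  have hfatou := lintegral_le_liminf_lintegral_of_forall_isOpen_measure_le_liminf_measure
    (μ := (μ : Measure ℝ)) (μs := fun n => (μs n : Measure ℝ)) (f := fun x : ℝ => |x| ^ β)
    (continuous_abs.rpow_const fun _ => Or.inr hβ) (fun x => by positivity)
    (fun G hG => ProbabilityMeasure.le_liminf_measure_open_of_tendsto hlim hG)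
  refine (hfatou.trans (liminf_le_of_frequently_le' (Frequently.of_forall hbound))).trans_lt ?_
  exact ENNReal.mul_lt_top (ENNReal.mul_lt_top ENNReal.ofReal_lt_top hB.lt_top) hgπ

theorem min_abs_rpow_le {β r R x : ℝ} (hβ : 0 ≤ β) (hR : 0 ≤ R) (hx : |x| ≤ r) (y : ℝ) :
    min (|y| ^ β) R ≤ 2 ^ β * (min (|x + y| ^ β) R + r ^ β) := by
  have hr : 0 ≤ r := (abs_nonneg x).trans hx
  have h2 : (1 : ℝ) ≤ 2 ^ β := Real.one_le_rpow (by norm_num) hβ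
  have hy : |y| ≤ |x + y| + r := by
    have := abs_sub (x + y) x
    rw [add_sub_cancel_left] at this
    linarith
  have hrβ : 0 ≤ r ^ β := by positivity
  have hsβ : 0 ≤ |x + y| ^ β := by positivity
  have hyβ : |y| ^ β ≤ 2 ^ β * (|x + y| ^ β + r ^ β) := by
    rcases le_total r (|x + y|) with h | h
    · have : |y| ^ β ≤ (2 * |x + y|) ^ β := Real.rpow_le_rpow (abs_nonneg y) (by linarith) hβ
      rw [Real.mul_rpow (by norm_num) (abs_nonneg _)] at this
      nlinarith
    · have : |y| ^ β ≤ (2 * r) ^ β := Real.rpow_le_rpow (abs_nonneg y) (by linarith) hβ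
      rw [Real.mul_rpow (by norm_num) hr] at this
      nlinarith
  rcases le_total (|x + y| ^ β) R with h | h
  · rw [min_eq_left h]
    exact (min_le_left _ _).trans hyβ
  · rw [min_eq_right h]
    refine (min_le_right _ _).trans ?_
    nlinarith

theorem lintegral_jump_abs_rpow_lt_top_of_tendsto_conv_compoundPoisson
    {ν : Measure ℝ} [IsFiniteMeasure ν] {γ : ℕ → Measure ℝ} [∀ n, IsProbabilityMeasure (γ n)]
    {B : ℝ≥0∞}
    (hB : B ≠ ⊤) (hγ : ∀ n, ∫⁻ x, ENNReal.ofReal (Real.exp |x|) ∂(γ n) ≤ B)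
    {μ : ProbabilityMeasure ℝ} {μs : ℕ → ProbabilityMeasure ℝ}
    (hμs : ∀ n, (μs n : Measure ℝ) = γ n ∗ compoundPoisson ν)
    (hlim : Tendsto μs atTop (𝓝 μ))
    {β : ℝ} (hβ : 0 ≤ β) (hint : ∫⁻ x, ENNReal.ofReal (|x| ^ β) ∂(μ : Measure ℝ) < ⊤) :
    ∫⁻ x, ENNReal.ofReal (|x| ^ β) ∂ν < ⊤ := by
  obtain ⟨r, hr0, hr⟩ : ∃ r : ℝ, 0 ≤ r ∧ ∀ n, 2⁻¹ ≤ γ n {x | |x| ≤ r} := by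
    refine ⟨2 * B.toReal, by positivity, fun n => ?_⟩
    have hmarkov : γ n {x | |x| ≤ 2 * B.toReal}ᶜ ≤ 2⁻¹ := by
      have hsub : {x : ℝ | |x| ≤ 2 * B.toReal}ᶜ ⊆
          {x | 2 * B + 1 ≤ ENNReal.ofReal (Real.exp |x|)} := fun x hx => by
        simp only [Set.mem_compl_iff, Set.mem_ofPred_eq, not_le] at hx ⊢
        rw [← ENNReal.ofReal_toReal hB, ← ENNReal.ofReal_one,
          show (2 : ℝ≥0∞) = ENNReal.ofReal 2 by simp, ← ENNReal.ofReal_mul (by norm_num),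
          ← ENNReal.ofReal_add (by positivity) (by norm_num)]
        exact ENNReal.ofReal_le_ofReal (by linarith [Real.add_one_le_exp |x|])
      refine (measure_mono hsub).trans ?_
      refine (meas_ge_le_lintegral_div (by fun_prop) (by simp)
        (ENNReal.add_ne_top.2 ⟨ENNReal.mul_ne_top (by simp) hB, by simp⟩)).trans ?_
      refine ENNReal.div_le_of_le_mul ((hγ n).trans ?_)
      rw [mul_add, ← mul_assoc, ENNReal.inv_mul_cancel (by simp) (by simp), one_mul]
      exact le_self_add
    have hm : MeasurableSet {x : ℝ | |x| ≤ 2 * B.toReal} :=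
      measurableSet_le (by fun_prop) (by fun_prop)
    have hone := measure_add_measure_compl (μ := γ n) hm
    rw [measure_univ] at hone
    by_contra! hlt
    have := ENNReal.add_lt_add_of_lt_of_le (by finiteness) hlt hmarkov
    rw [hone, ENNReal.inv_two_add_inv_two] at this
    exact lt_irrefl _ this
  set c : ℝ≥0∞ := ENNReal.ofReal (Real.exp (-ν.real Set.univ)) with hc_def
  have hc0 : c ≠ 0 := by simp [hc_def, Real.exp_pos]
  have hct : c ≠ ⊤ := ENNReal.ofReal_ne_top
  set K : ℝ≥0∞ := ENNReal.ofReal (2 ^ β) with hK_def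
  set f : ℕ → ℝ → ℝ≥0∞ := fun R x => ENNReal.ofReal (min (|x| ^ β) R) with hf_def
  have hfm : ∀ R, Measurable (f R) := fun R => by fun_prop
  have hpt : ∀ R n y, f R y ≤ 2 * K * (∫⁻ x, f R (x + y) ∂(γ n) + ENNReal.ofReal (r ^ β)) := by
    intro R n y
    have h1 : 2⁻¹ * f R y ≤ K * (∫⁻ x, f R (x + y) ∂(γ n) + ENNReal.ofReal (r ^ β)) :=
      calc 2⁻¹ * f R y ≤ γ n {x | |x| ≤ r} * f R y := by gcongr; exact hr n
        _ = ∫⁻ _ in {x | |x| ≤ r}, f R y ∂(γ n) := by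
          rw [setLIntegral_const, mul_comm]
        _ ≤ ∫⁻ x in {x | |x| ≤ r}, K * (f R (x + y) + ENNReal.ofReal (r ^ β)) ∂(γ n) := by
          refine setLIntegral_mono (by fun_prop) fun x hx => ?_
          rw [hf_def, hK_def, ← ENNReal.ofReal_add (by positivity) (by positivity),
            ← ENNReal.ofReal_mul (by positivity)]
          exact ENNReal.ofReal_le_ofReal (min_abs_rpow_le hβ (by positivity) hx y)
        _ ≤ ∫⁻ x, K * (f R (x + y) + ENNReal.ofReal (r ^ β)) ∂(γ n) := setLIntegral_le_lintegral _ _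
        _ = _ := by
          rw [lintegral_const_mul _ (by fun_prop), lintegral_add_right _ (by fun_prop)]
          simp
    calc f R y = 2 * (2⁻¹ * f R y) := by
          rw [← mul_assoc, ENNReal.mul_inv_cancel (by simp) (by simp), one_mul]
      _ ≤ 2 * (K * (∫⁻ x, f R (x + y) ∂(γ n) + ENNReal.ofReal (r ^ β))) := by gcongr
      _ = _ := by rw [mul_assoc]
  have hn : ∀ R n, ∫⁻ y, f R y ∂ν ≤
      2 * K * (c⁻¹ * ∫⁻ x, f R x ∂(μs n : Measure ℝ) + ENNReal.ofReal (r ^ β) * ν Set.univ) := by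
    intro R n
    have hdom : ∫⁻ y, ∫⁻ x, f R (x + y) ∂(γ n) ∂ν ≤ c⁻¹ * ∫⁻ x, f R x ∂(μs n : Measure ℝ) := by
      have h := lintegral_mono' (smul_le_compoundPoisson ν)
        (le_refl fun y => ∫⁻ x, f R (x + y) ∂(γ n))
      rw [lintegral_smul_measure, smul_eq_mul] at h
      rw [hμs, Measure.conv_comm, Measure.lintegral_conv (hfm R), ← ENNReal.div_eq_inv_mul,
        ENNReal.le_div_iff_mul_le (Or.inl hc0) (Or.inl hct), mul_comm]
      simpa only [add_comm] using h
    calc ∫⁻ y, f R y ∂ν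
        ≤ ∫⁻ y, 2 * K * (∫⁻ x, f R (x + y) ∂(γ n) + ENNReal.ofReal (r ^ β)) ∂ν :=
          lintegral_mono fun y => hpt R n y
      _ = 2 * K * (∫⁻ y, ∫⁻ x, f R (x + y) ∂(γ n) ∂ν + ENNReal.ofReal (r ^ β) * ν Set.univ) := by
          have hm : Measurable fun y => ∫⁻ x, f R (x + y) ∂(γ n) :=
            Measurable.lintegral_prod_left' (f := fun p : ℝ × ℝ => f R (p.1 + p.2)) (by fun_prop)
          rw [lintegral_const_mul _ (by fun_prop), lintegral_add_right _ (by fun_prop),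
            lintegral_const]
      _ ≤ _ := by gcongr
  have hR : ∀ R, ∫⁻ y, f R y ∂ν ≤ 2 * K * (c⁻¹ * ∫⁻ x, ENNReal.ofReal (|x| ^ β) ∂(μ : Measure ℝ) +
      ENNReal.ofReal (r ^ β) * ν Set.univ) := by
    intro R
    have hcont : Continuous fun x : ℝ => min (|x| ^ β) (R : ℝ) :=
      (continuous_abs.rpow_const fun _ => Or.inr hβ).min continuous_const
    let F : BoundedContinuousFunction ℝ ℝ≥0 := BoundedContinuousFunction.mkOfBound
      ⟨fun x => (min (|x| ^ β) (R : ℝ)).toNNReal, by fun_prop⟩ R fun x y => by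
        have h0 : 0 ≤ min (|x| ^ β) (R : ℝ) := by positivity
        have h1 : 0 ≤ min (|y| ^ β) (R : ℝ) := by positivity
        rw [NNReal.dist_eq]
        simp only [ContinuousMap.coe_mk, Real.coe_toNNReal _ h0, Real.coe_toNNReal _ h1]
        rw [abs_le]
        constructor <;> linarith [min_le_right (|x| ^ β) (R : ℝ), min_le_right (|y| ^ β) (R : ℝ)]
    have hF := ProbabilityMeasure.tendsto_iff_forall_lintegral_tendsto.1 hlim F
    have hlimR : ∫⁻ y, f R y ∂ν ≤ 2 * K * (c⁻¹ * ∫⁻ x, f R x ∂(μ : Measure ℝ) +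
        ENNReal.ofReal (r ^ β) * ν Set.univ) := by
      refine ge_of_tendsto' (ENNReal.Tendsto.const_mul (Tendsto.add
        (ENNReal.Tendsto.const_mul hF (Or.inr (by simp [hc0]))) tendsto_const_nhds)
          (Or.inr (by finiteness))) (hn R)
    refine hlimR.trans ?_
    gcongr with x
    exact ENNReal.ofReal_le_ofReal (min_le_left _ _)
  have hsup : ∫⁻ x, ENNReal.ofReal (|x| ^ β) ∂ν = ⨆ R, ∫⁻ x, f R x ∂ν := by
    rw [← lintegral_iSup hfm]
    · refine lintegral_congr fun x => le_antisymm ?_ (iSup_le fun R => ?_)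
      · obtain ⟨R, hR⟩ := exists_nat_ge (|x| ^ β)
        refine le_trans ?_ (le_iSup _ R)
        simp only [hf_def, min_eq_left hR, le_refl]
      · exact ENNReal.ofReal_le_ofReal (min_le_left _ _)
    · intro R S hRS x
      exact ENNReal.ofReal_le_ofReal (min_le_min_left _ (by exact_mod_cast hRS))
  rw [hsup]
  refine (iSup_le hR).trans_lt ?_
  have hci : c⁻¹ < ⊤ := by simp [hc_def, Real.exp_pos]
  have h1 : c⁻¹ * ∫⁻ x, ENNReal.ofReal (|x| ^ β) ∂(μ : Measure ℝ) < ⊤ := ENNReal.mul_lt_top hci hint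
  finiteness

/-- The integrand of the Lévy–Khintchine exponent. -/
noncomputable def levyKernel (t x : ℝ) : ℂ :=
  Complex.exp (Complex.I * ((t * x : ℝ) : ℂ)) - 1
    - Complex.I * ((t * x : ℝ) : ℂ) / ((1 + x ^ 2 : ℝ) : ℂ)

theorem norm_cexp_I_mul_sub_one_le_two (u : ℝ) : ‖Complex.exp (Complex.I * (u : ℂ)) - 1‖ ≤ 2 := by
  refine (norm_sub_le _ _).trans ?_
  rw [mul_comm, Complex.norm_exp_ofReal_mul_I]
  norm_num

theorem norm_cexp_I_mul_sub_one_sub_le (u : ℝ) :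
    ‖Complex.exp (Complex.I * (u : ℂ)) - 1 - Complex.I * (u : ℂ)‖ ≤ 3 * u ^ 2 := by
  have hnorm : ‖Complex.I * (u : ℂ)‖ = |u| := by simp
  rcases le_total |u| 1 with h | h
  · have h1 := Complex.norm_exp_sub_sum_le_norm_mul_exp (Complex.I * (u : ℂ)) 2
    simp only [Finset.sum_range_succ, Finset.sum_range_zero, hnorm, sq_abs] at h1
    have h2 : Real.exp |u| ≤ 3 :=
      (Real.exp_le_exp.2 h).trans (by linarith [Real.exp_one_lt_d9])
    calc _ = _ := by congr 1; simp; ring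
      _ ≤ _ := h1
      _ ≤ 3 * u ^ 2 := by nlinarith [sq_nonneg u]
  · refine (norm_sub_le _ _).trans ?_
    rw [hnorm]
    nlinarith [norm_cexp_I_mul_sub_one_le_two u, sq_abs u]

theorem norm_levyKernel_le (t x : ℝ) :
    ‖levyKernel t x‖ ≤ (3 * t ^ 2 + 2) * (x ^ 2 / (1 + x ^ 2)) := by
  have hpos : 0 < 1 + x ^ 2 := by positivity
  have hne : ((1 + x ^ 2 : ℝ) : ℂ) ≠ 0 := by exact_mod_cast hpos.ne'
  have heq : levyKernel t x =
      ((Complex.exp (Complex.I * ((t * x : ℝ) : ℂ)) - 1 - Complex.I * ((t * x : ℝ) : ℂ))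
        + (x ^ 2 : ℝ) * (Complex.exp (Complex.I * ((t * x : ℝ) : ℂ)) - 1))
        / ((1 + x ^ 2 : ℝ) : ℂ) := by
    rw [levyKernel, eq_div_iff hne, sub_mul, div_mul_cancel₀ _ hne]
    push_cast
    ring
  rw [heq, norm_div, Complex.norm_real, Real.norm_of_nonneg hpos.le, ← mul_div_assoc]
  gcongr
  refine (norm_add_le _ _).trans ?_
  rw [norm_mul, Complex.norm_real, Real.norm_of_nonneg (sq_nonneg x)]
  nlinarith [norm_cexp_I_mul_sub_one_sub_le (t * x), norm_cexp_I_mul_sub_one_le_two (t * x),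
    sq_nonneg x]

theorem measurable_levyKernel (t : ℝ) : Measurable (levyKernel t) := by
  unfold levyKernel
  fun_prop

theorem abs_exp_sub_one_sub_div_le {s τ x : ℝ} (hs : |s| = 1) (hx : |x| ≤ τ) :
    |Real.exp (s * x) - 1 - s * (x / (1 + x ^ 2))| ≤
      (Real.exp τ * (1 + τ ^ 2) + τ) * (x ^ 2 / (1 + x ^ 2)) := by
  have hpos : 0 < 1 + x ^ 2 := by positivity
  have hτ : 0 ≤ τ := (abs_nonneg x).trans hx
  have habs : |s * x| = |x| := by rw [abs_mul, hs, one_mul]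
  have hsq : x ^ 2 ≤ τ ^ 2 := by rw [← sq_abs]; gcongr
  have h1 : |Real.exp (s * x) - 1 - s * x| ≤ x ^ 2 * Real.exp τ := by
    have h := Complex.norm_exp_sub_sum_le_norm_mul_exp ((s * x : ℝ) : ℂ) 2
    rw [Complex.norm_real, Real.norm_eq_abs, habs, sq_abs] at h
    have he : Complex.exp ((s * x : ℝ) : ℂ) - ∑ m ∈ Finset.range 2, ((s * x : ℝ) : ℂ) ^ m / m ! =
        ((Real.exp (s * x) - 1 - s * x : ℝ) : ℂ) := by
      simp [Finset.sum_range_succ]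
      ring
    rw [he, Complex.norm_real, Real.norm_eq_abs] at h
    exact h.trans (by gcongr)
  have h2 : |s * x - s * (x / (1 + x ^ 2))| ≤ τ * (x ^ 2 / (1 + x ^ 2)) := by
    have : s * x - s * (x / (1 + x ^ 2)) = s * (x * (x ^ 2 / (1 + x ^ 2))) := by
      field_simp
      ring
    rw [this, abs_mul, hs, one_mul, abs_mul, abs_of_nonneg (by positivity : 0 ≤ x ^ 2 / (1 + x ^ 2))]
    gcongr
  have h3 : x ^ 2 * Real.exp τ ≤ Real.exp τ * (1 + τ ^ 2) * (x ^ 2 / (1 + x ^ 2)) := by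
    rw [← mul_div_assoc, le_div_iff₀ hpos]
    have : 0 ≤ Real.exp τ * x ^ 2 := by positivity
    nlinarith
  have h4 := abs_add_le (Real.exp (s * x) - 1 - s * x) (s * x - s * (x / (1 + x ^ 2)))
  rw [sub_add_sub_cancel] at h4
  linarith

theorem norm_div_one_add_sq_le (x : ℝ) : ‖x / (1 + x ^ 2)‖ ≤ 1 := by
  rw [norm_div, Real.norm_eq_abs, Real.norm_of_nonneg (by positivity), div_le_one (by positivity)]
  nlinarith [sq_abs x, sq_nonneg (|x| - 1)]

theorem integrable_div_one_add_sq (ρ : Measure ℝ) [IsFiniteMeasure ρ] :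
    Integrable (fun x : ℝ => x / (1 + x ^ 2)) ρ :=
  Integrable.of_bound (Measurable.aestronglyMeasurable (by fun_prop)) 1
    (ae_of_all _ norm_div_one_add_sq_le)

theorem charFun_compoundPoisson_eq_exp_levyKernel (ρ : Measure ℝ) [IsFiniteMeasure ρ] (t : ℝ) :
    charFun (compoundPoisson ρ) t =
      Complex.exp (∫ x, levyKernel t x ∂ρ
        + Complex.I * ((t * ∫ x, x / (1 + x ^ 2) ∂ρ : ℝ) : ℂ)) := by
  rw [charFun_compoundPoisson]
  congr 1
  have h1 : Integrable (fun x : ℝ => Complex.exp (Complex.I * ((t * x : ℝ) : ℂ))) ρ := by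
    refine Integrable.of_bound (by fun_prop) 1 (ae_of_all _ fun x => ?_)
    rw [mul_comm, Complex.norm_exp_ofReal_mul_I]
  have h2 : Integrable (fun x : ℝ => Complex.I * t * ((x / (1 + x ^ 2) : ℝ) : ℂ)) ρ :=
    (integrable_div_one_add_sq ρ).ofReal.const_mul _
  have hk : levyKernel t = fun x => Complex.exp (Complex.I * ((t * x : ℝ) : ℂ)) - 1
      - Complex.I * t * ((x / (1 + x ^ 2) : ℝ) : ℂ) := by
    ext x
    rw [levyKernel]
    push_cast
    ring
  have h3 : Integrable (fun x : ℝ => Complex.exp (Complex.I * ((t * x : ℝ) : ℂ)) - 1) ρ :=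
    h1.sub (integrable_const _)
  rw [hk, integral_sub h3 h2, integral_sub h1 (integrable_const _),
    integral_const_mul, integral_complex_ofReal, charFun_apply_real]
  simp only [integral_const, Complex.real_smul, mul_one]
  push_cast
  have : ∀ x : ℝ, Complex.exp (t * x * Complex.I) = Complex.exp (Complex.I * (t * x)) :=
    fun x => by rw [mul_comm]
  simp only [this]
  ring

theorem measure_le_abs_lt_top {ν : Measure ℝ}
    (hν : ∫⁻ x, ENNReal.ofReal (x ^ 2 / (1 + x ^ 2)) ∂ν < ⊤) {ε : ℝ} (hε : 0 < ε) :
    ν {x | ε ≤ |x|} < ⊤ := by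
  have hsub : {x : ℝ | ε ≤ |x|} ⊆
      {x | ENNReal.ofReal (ε ^ 2 / (1 + ε ^ 2)) ≤ ENNReal.ofReal (x ^ 2 / (1 + x ^ 2))} := by
    intro x hx
    have hsq : ε ^ 2 ≤ x ^ 2 := by
      rw [← sq_abs x]
      exact pow_le_pow_left₀ hε.le hx 2
    refine ENNReal.ofReal_le_ofReal ?_
    rw [div_le_div_iff₀ (by positivity) (by positivity)]
    nlinarith
  refine (measure_mono hsub).trans_lt ?_
  refine (meas_ge_le_lintegral_div (by fun_prop) ?_ ENNReal.ofReal_ne_top).trans_lt ?_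
  · simp only [ne_eq, ENNReal.ofReal_eq_zero, not_le]
    positivity
  · refine ENNReal.div_lt_top hν.ne ?_
    simp only [ne_eq, ENNReal.ofReal_eq_zero, not_le]
    positivity

theorem lintegral_exp_mul_gaussianReal (m : ℝ) (v : ℝ≥0) (s : ℝ) :
    ∫⁻ x, ENNReal.ofReal (Real.exp (s * x)) ∂(gaussianReal m v) =
      ENNReal.ofReal (Real.exp (m * s + v * s ^ 2 / 2)) := by
  rw [← ofReal_integral_eq_lintegral_ofReal (integrable_exp_mul_gaussianReal s)
    (ae_of_all _ fun x => (Real.exp_pos _).le)]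
  congr 1
  exact mgf_gaussianReal (p := gaussianReal m v) (X := id) (by simp) s

theorem lintegral_exp_mul_conv_compoundPoisson_le {ρ : Measure ℝ} [IsFiniteMeasure ρ] {s τ W : ℝ}
    (hs : |s| = 1) (hρ : ∀ᵐ x ∂ρ, |x| ≤ τ) (hw : Integrable (fun x : ℝ => x ^ 2 / (1 + x ^ 2)) ρ)
    (hW : ∫ x, x ^ 2 / (1 + x ^ 2) ∂ρ ≤ W) (hτ : 0 ≤ τ) (b : ℝ) (v : ℝ≥0) :
    ∫⁻ x, ENNReal.ofReal (Real.exp (s * x))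
        ∂(gaussianReal (b - ∫ x, x / (1 + x ^ 2) ∂ρ) v ∗ compoundPoisson ρ) ≤
      ENNReal.ofReal (Real.exp (|b| + v / 2 + (Real.exp τ * (1 + τ ^ 2) + τ) * W)) := by
  have hexp : Integrable (fun x => Real.exp (s * x)) ρ := by
    refine Integrable.of_bound (by fun_prop) (Real.exp τ) (hρ.mono fun x hx => ?_)
    rw [Real.norm_of_nonneg (Real.exp_pos _).le, Real.exp_le_exp]
    refine (le_abs_self _).trans ?_
    rwa [abs_mul, hs, one_mul]
  have hadd : ∀ x y : ℝ, ENNReal.ofReal (Real.exp (s * (x + y))) ≤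
      ENNReal.ofReal (Real.exp (s * x)) * ENNReal.ofReal (Real.exp (s * y)) := fun x y => by
    rw [← ENNReal.ofReal_mul (Real.exp_pos _).le, ← Real.exp_add, mul_add]
  have hm : Measurable fun x : ℝ => ENNReal.ofReal (Real.exp (s * x)) := by fun_prop
  have hcp := lintegral_compoundPoisson_le hm (by simp) hadd ρ
    (integral_nonneg fun x => (Real.exp_pos (s * x)).le)
    (ofReal_integral_eq_lintegral_ofReal hexp (ae_of_all _ fun x => (Real.exp_pos _).le)).ge
  refine (lintegral_conv_le_mul hm hadd _ _).trans ?_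
  rw [lintegral_exp_mul_gaussianReal]
  refine (mul_le_mul_right hcp _).trans ?_
  rw [← ENNReal.ofReal_mul (Real.exp_pos _).le, ← Real.exp_add]
  refine ENNReal.ofReal_le_ofReal (Real.exp_le_exp.2 ?_)
  have hs2 : s ^ 2 = 1 := by rw [← sq_abs, hs, one_pow]
  have hbs : b * s ≤ |b| := (le_abs_self _).trans (by rw [abs_mul, hs, mul_one])
  have hmi := integrable_div_one_add_sq ρ
  have heq : ∫ x, (Real.exp (s * x) - 1 - s * (x / (1 + x ^ 2))) ∂ρ =
      ∫ x, Real.exp (s * x) ∂ρ - ρ.real Set.univ - s * ∫ x, x / (1 + x ^ 2) ∂ρ := by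
    rw [integral_sub (f := fun x => Real.exp (s * x) - 1) (hexp.sub (integrable_const _))
        (hmi.const_mul s),
      integral_sub hexp (integrable_const _), integral_const_mul]
    simp
  have hle : ∫ x, (Real.exp (s * x) - 1 - s * (x / (1 + x ^ 2))) ∂ρ ≤
      (Real.exp τ * (1 + τ ^ 2) + τ) * W := by
    calc _ ≤ ∫ x, (Real.exp τ * (1 + τ ^ 2) + τ) * (x ^ 2 / (1 + x ^ 2)) ∂ρ := by
          refine integral_mono_ae ((hexp.sub (integrable_const _)).sub (hmi.const_mul s))
            (hw.const_mul _) (hρ.mono fun x hx => ?_)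
          exact (le_abs_self _).trans (abs_exp_sub_one_sub_div_le hs hx)
      _ ≤ _ := by
          rw [integral_const_mul]
          gcongr
  rw [hs2]
  linarith

theorem lintegral_exp_abs_conv_compoundPoisson_le {ρ : Measure ℝ} [IsFiniteMeasure ρ] {τ W : ℝ}
    (hρ : ∀ᵐ x ∂ρ, |x| ≤ τ) (hw : Integrable (fun x : ℝ => x ^ 2 / (1 + x ^ 2)) ρ)
    (hW : ∫ x, x ^ 2 / (1 + x ^ 2) ∂ρ ≤ W) (hτ : 0 ≤ τ) (b : ℝ) (v : ℝ≥0) :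
    ∫⁻ x, ENNReal.ofReal (Real.exp |x|)
        ∂(gaussianReal (b - ∫ x, x / (1 + x ^ 2) ∂ρ) v ∗ compoundPoisson ρ) ≤
      2 * ENNReal.ofReal (Real.exp (|b| + v / 2 + (Real.exp τ * (1 + τ ^ 2) + τ) * W)) := by
  have h1 := lintegral_exp_mul_conv_compoundPoisson_le (s := 1) (by simp) hρ hw hW hτ b v
  have h2 := lintegral_exp_mul_conv_compoundPoisson_le (s := -1) (by simp) hρ hw hW hτ b v
  rw [two_mul]
  refine le_trans ?_ (add_le_add h1 h2)
  rw [← lintegral_add_left (by fun_prop)]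
  refine lintegral_mono fun x => ?_
  rw [← ENNReal.ofReal_add (Real.exp_pos _).le (Real.exp_pos _).le]
  refine ENNReal.ofReal_le_ofReal ?_
  rcases abs_cases x with ⟨h, _⟩ | ⟨h, _⟩ <;> rw [h] <;> simp [Real.exp_nonneg]

theorem tendsto_setIntegral_levyKernel {ν : Measure ℝ}
    (hw : Integrable (fun x : ℝ => x ^ 2 / (1 + x ^ 2)) ν) (τ t : ℝ) :
    Tendsto (fun n : ℕ => ∫ x in ((|·|) ⁻¹' Set.Ico (1 / ((n : ℝ) + 1)) τ), levyKernel t x ∂ν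
      + ∫ x in {x | τ ≤ |x|}, levyKernel t x ∂ν) atTop (𝓝 (∫ x, levyKernel t x ∂ν)) := by
  have hint : Integrable (levyKernel t) ν :=
    (hw.const_mul (3 * t ^ 2 + 2)).mono' (measurable_levyKernel t).aestronglyMeasurable
      (ae_of_all _ (norm_levyKernel_le t))
  have hmA : ∀ n : ℕ, MeasurableSet ((|·|) ⁻¹' Set.Ico (1 / ((n : ℝ) + 1)) τ : Set ℝ) := fun n =>
    measurableSet_Ico.preimage measurable_norm
  have hmT : MeasurableSet {x : ℝ | τ ≤ |x|} := measurableSet_le (by fun_prop) (by fun_prop)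
  have hdisj : ∀ n : ℕ, Disjoint ((|·|) ⁻¹' Set.Ico (1 / ((n : ℝ) + 1)) τ : Set ℝ) {x | τ ≤ |x|} :=
    fun n => Set.disjoint_left.2 fun x hx hx' => not_lt.2 hx' hx.2
  have hmono : Monotone fun n : ℕ =>
      ((|·|) ⁻¹' Set.Ico (1 / ((n : ℝ) + 1)) τ : Set ℝ) ∪ {x | τ ≤ |x|} := by
    intro m n hmn
    refine Set.union_subset_union_left _ fun x hx => ⟨le_trans ?_ hx.1, hx.2⟩
    exact one_div_le_one_div_of_le (by positivity) (by gcongr)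
  have h := tendsto_setIntegral_of_monotone (μ := ν) (f := levyKernel t)
    (fun n => (hmA n).union hmT) hmono hint.integrableOn
  rw [setIntegral_eq_integral_of_forall_compl_eq_zero] at h
  · refine h.congr fun n => ?_
    exact setIntegral_union (hdisj n) hmT hint.integrableOn hint.integrableOn
  · intro x hx
    have hx0 : x = 0 := by
      by_contra hne
      refine hx (Set.mem_iUnion.2 ?_)
      obtain ⟨n, hn⟩ := exists_nat_one_div_lt (abs_pos.2 hne)
      refine ⟨n, ?_⟩
      rcases lt_or_ge |x| τ with h | h
      · exact Or.inl ⟨hn.le, h⟩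
      · exact Or.inr h
    simp [levyKernel, hx0]

/-- **Corollary 1 (Ramachandran's theorem).** Let `X` be an infinitely divisible random
variable whose characteristic function has the Lévy–Khintchine form with Lévy measure `ν`,
and let `β ∈ [0,∞)`.  Then `E(|X|^β) < ∞` if and only if `∫ |x|^β dν₁(x) < ∞`, where `ν₁`
is the restriction of `ν` to `{x : |x| ≥ τ}`. -/
theorem ramachandran_moment_iff_levy_restriction
    {Ω : Type*} [MeasurableSpace Ω] (P : Measure Ω) [IsProbabilityMeasure P]
    (X : Ω → ℝ) (hX : Measurable X)
    (a : ℝ) (q : ℝ) (hq : 0 ≤ q)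
    (ν : Measure ℝ)
    (hν0 : ν {0} = 0)
    (hνint : ∫⁻ x, ENNReal.ofReal (x ^ 2 / (1 + x ^ 2)) ∂ν < ⊤)
    (hφ : ∀ t : ℝ,
      ∫ ω, Complex.exp (Complex.I * ((t * X ω : ℝ) : ℂ)) ∂P =
        Complex.exp (Complex.I * ((a * t : ℝ) : ℂ) - ((q * t ^ 2 : ℝ) : ℂ) / 2
          + ∫ x, (Complex.exp (Complex.I * ((t * x : ℝ) : ℂ)) - 1
              - Complex.I * ((t * x : ℝ) : ℂ) / ((1 + x ^ 2 : ℝ) : ℂ)) ∂ν))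
    (τ : ℝ) (hτ : 0 < τ)
    (β : ℝ) (hβ : 0 ≤ β) :
    (∫⁻ ω, ENNReal.ofReal (|X ω| ^ β) ∂P < ⊤) ↔
      (∫⁻ x, ENNReal.ofReal (|x| ^ β) ∂(ν.restrict {x | τ ≤ |x|}) < ⊤) := by
  set ν₁ := ν.restrict {x | τ ≤ |x|} with hν₁
  have hmT : MeasurableSet {x : ℝ | τ ≤ |x|} := measurableSet_le (by fun_prop) (by fun_prop)
  have hfin₁ : IsFiniteMeasure ν₁ := isFiniteMeasure_restrict.2 (measure_le_abs_lt_top hνint hτ).ne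
  let A : ℕ → Set ℝ := fun n => ((|·|) ⁻¹' Set.Ico (1 / ((n : ℝ) + 1)) τ)
  have hmA : ∀ n, MeasurableSet (A n) := fun n =>
    measurableSet_Ico.preimage measurable_norm
  have hfin : ∀ n, IsFiniteMeasure (ν.restrict (A n)) := fun n =>
    isFiniteMeasure_restrict.2 ((measure_mono fun x hx => hx.1).trans_lt
      (measure_le_abs_lt_top hνint (by positivity : (0 : ℝ) < 1 / ((n : ℝ) + 1)))).ne
  have hw : Integrable (fun x : ℝ => x ^ 2 / (1 + x ^ 2)) ν := by
    refine ⟨Measurable.aestronglyMeasurable (by fun_prop), ?_⟩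
    rwa [hasFiniteIntegral_iff_ofReal (ae_of_all _ fun x => by positivity)]
  let b : ℝ := a - ∫ x, x / (1 + x ^ 2) ∂ν₁
  let γ : ℕ → Measure ℝ := fun n =>
    gaussianReal (b - ∫ x, x / (1 + x ^ 2) ∂(ν.restrict (A n))) q.toNNReal
      ∗ compoundPoisson (ν.restrict (A n))
  have hγ := fun n => lintegral_exp_abs_conv_compoundPoisson_le (ρ := ν.restrict (A n))
    (ae_restrict_of_forall_mem (hmA n) fun x hx => hx.2.le) hw.integrableOn
    (setIntegral_le_integral hw (ae_of_all _ fun x => by positivity)) hτ.le b q.toNNReal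
  let μ : ProbabilityMeasure ℝ := ⟨P.map X, Measure.isProbabilityMeasure_map hX.aemeasurable⟩
  let μs : ℕ → ProbabilityMeasure ℝ := fun n => ⟨γ n ∗ compoundPoisson ν₁, inferInstance⟩
  have hlim : Tendsto μs atTop (𝓝 μ) := by
    refine ProbabilityMeasure.tendsto_of_tendsto_charFun fun t => ?_
    have hμ : charFun (μ : Measure ℝ) t = Complex.exp (Complex.I * ((a * t : ℝ) : ℂ)
        - ((q * t ^ 2 : ℝ) : ℂ) / 2 + ∫ x, levyKernel t x ∂ν) := by
      refine Eq.trans ?_ (hφ t)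
      rw [charFun_apply_real]
      simp only [μ, ProbabilityMeasure.coe_mk]
      rw [integral_map hX.aemeasurable (by fun_prop)]
      refine integral_congr_ae (ae_of_all _ fun ω => ?_)
      simp only [Complex.ofReal_mul, mul_comm Complex.I]
    have hμs : ∀ n, charFun (μs n : Measure ℝ) t = Complex.exp (Complex.I * ((a * t : ℝ) : ℂ)
        - ((q * t ^ 2 : ℝ) : ℂ) / 2 + (∫ x in A n, levyKernel t x ∂ν
          + ∫ x, levyKernel t x ∂ν₁)) := by
      intro n
      simp only [μs, γ, ProbabilityMeasure.coe_mk]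
      rw [charFun_conv, charFun_conv, charFun_gaussianReal,
        charFun_compoundPoisson_eq_exp_levyKernel, charFun_compoundPoisson_eq_exp_levyKernel,
        ← Complex.exp_add, ← Complex.exp_add, Real.coe_toNNReal q hq]
      congr 1
      simp only [b]
      push_cast
      ring
    simp only [hμ, hμs]
    exact (Complex.continuous_exp.tendsto _).comp
      ((tendsto_setIntegral_levyKernel hw τ t).const_add _)
  have hmap : ∫⁻ ω, ENNReal.ofReal (|X ω| ^ β) ∂P =
      ∫⁻ x, ENNReal.ofReal (|x| ^ β) ∂(μ : Measure ℝ) :=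
    (lintegral_map (f := fun x : ℝ => ENNReal.ofReal (|x| ^ β)) (by fun_prop) hX).symm
  rw [hmap]
  exact ⟨lintegral_jump_abs_rpow_lt_top_of_tendsto_conv_compoundPoisson (ν := ν₁)
      (by finiteness) hγ
      (fun n => rfl) hlim hβ,
    lintegral_abs_rpow_lt_top_of_tendsto_conv_compoundPoisson (ν := ν₁) (by finiteness) hγ
      (fun n => rfl) hlim hτ (ae_restrict_mem hmT) hβ⟩
end

section
/- (Theorem 2) Let X = (X₁,…,X_p) be as in the Lévy–Khintchine setup, let β_r ∈ [0,∞) for r = 1,…,p, and assume additionally that P(X_r = 0) < 1 for each r = 1,…,p. Then the condition that E(∏_{r=1}^{p} |X_r|^{α_r}) < ∞ for all α_r ∈ [0, β_r], r = 1,…,p, is equivalent to the single condition E(∏_{r=1}^{p} |X_r|^{β_r}) < ∞. Moreover, under these assumptions, P(∏_{r=1}^{p} |X_r| > 0) > 0. -/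
open MeasureTheory ProbabilityTheory
open scoped RealInnerProductSpace

section LevyIntegrand

variable {E : Type*} [NormedAddCommGroup E] [InnerProductSpace ℝ E]

/-- The integrand of the jump part of the Lévy–Khintchine exponent. -/
noncomputable def levyIntegrand (t x : E) : ℂ :=
  Complex.exp (Complex.I * ((⟪t, x⟫ : ℝ) : ℂ)) - 1
    - Complex.I * ((⟪t, x⟫ : ℝ) : ℂ) / ((1 + ‖x‖ ^ 2 : ℝ) : ℂ)

lemma norm_exp_I_mul_sub_one_sub_le (s : ℝ) :
    ‖Complex.exp (Complex.I * s) - 1 - Complex.I * s‖ ≤ 2 * s ^ 2 := by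
  have hs : ‖Complex.I * (s : ℂ)‖ = |s| := by simp
  rcases le_total |s| 1 with h | h
  · refine (Complex.norm_exp_sub_one_sub_id_le (by rwa [hs])).trans ?_
    rw [hs, sq_abs]
    nlinarith [sq_nonneg s]
  · refine (norm_sub_le _ _).trans ?_
    have h1 := Real.norm_exp_I_mul_ofReal_sub_one_le (x := s)
    rw [Real.norm_eq_abs] at h1
    rw [hs, ← sq_abs]
    nlinarith

lemma norm_levyIntegrand_le (t x : E) :
    ‖levyIntegrand t x‖ ≤ (4 * ‖t‖ ^ 2 + ‖t‖ + 4) * (‖x‖ ^ 2 / (1 + ‖x‖ ^ 2)) := by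
  have hpos : 0 < 1 + ‖x‖ ^ 2 := by positivity
  have hin : |(⟪t, x⟫ : ℝ)| ≤ ‖t‖ * ‖x‖ := abs_real_inner_le_norm t x
  have ht := norm_nonneg t
  have hx := norm_nonneg x
  rw [← mul_div_assoc, le_div_iff₀ hpos]
  rcases le_total ‖x‖ 1 with h | h
  · have heq : levyIntegrand t x = (Complex.exp (Complex.I * ((⟪t, x⟫ : ℝ) : ℂ)) - 1
        - Complex.I * ((⟪t, x⟫ : ℝ) : ℂ))
        + Complex.I * ((⟪t, x⟫ * (‖x‖ ^ 2 / (1 + ‖x‖ ^ 2)) : ℝ) : ℂ) := by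
      have : ((1 + ‖x‖ ^ 2 : ℝ) : ℂ) ≠ 0 := by exact_mod_cast hpos.ne'
      rw [levyIntegrand]
      push_cast at this ⊢
      field_simp
      ring
    have hn : ‖levyIntegrand t x‖
        ≤ 2 * (‖t‖ * ‖x‖) ^ 2 + ‖t‖ * ‖x‖ * (‖x‖ ^ 2 / (1 + ‖x‖ ^ 2)) := by
      rw [heq]
      refine (norm_add_le _ _).trans (add_le_add
        ((norm_exp_I_mul_sub_one_sub_le _).trans ?_) ?_)
      · rw [← sq_abs]
        gcongr
      · rw [norm_mul, Complex.norm_I, one_mul, Complex.norm_real, Real.norm_eq_abs, abs_mul,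
          abs_of_nonneg (a := ‖x‖ ^ 2 / (1 + ‖x‖ ^ 2)) (by positivity)]
        gcongr
    calc ‖levyIntegrand t x‖ * (1 + ‖x‖ ^ 2)
        ≤ (2 * (‖t‖ * ‖x‖) ^ 2 + ‖t‖ * ‖x‖ * (‖x‖ ^ 2 / (1 + ‖x‖ ^ 2))) * (1 + ‖x‖ ^ 2) := by
          gcongr
      _ = 2 * ‖t‖ ^ 2 * ‖x‖ ^ 2 * (1 + ‖x‖ ^ 2) + ‖t‖ * ‖x‖ ^ 2 * ‖x‖ := by
          field_simp
      _ ≤ 2 * ‖t‖ ^ 2 * ‖x‖ ^ 2 * (1 + 1) + ‖t‖ * ‖x‖ ^ 2 * 1 := by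
          gcongr
          exact pow_le_one₀ hx h
      _ ≤ (4 * ‖t‖ ^ 2 + ‖t‖ + 4) * ‖x‖ ^ 2 := by nlinarith [sq_nonneg ‖x‖]
  · have hn : ‖levyIntegrand t x‖ ≤ 2 + ‖t‖ * ‖x‖ / (1 + ‖x‖ ^ 2) := by
      refine (norm_sub_le _ _).trans (add_le_add ((norm_sub_le _ _).trans ?_) ?_)
      · rw [mul_comm, Complex.norm_exp_ofReal_mul_I, norm_one]
        norm_num
      · rw [norm_div, norm_mul, Complex.norm_I, one_mul, Complex.norm_real, Complex.norm_real,
          Real.norm_eq_abs, Real.norm_eq_abs, abs_of_pos hpos]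
        gcongr
    calc ‖levyIntegrand t x‖ * (1 + ‖x‖ ^ 2)
        ≤ (2 + ‖t‖ * ‖x‖ / (1 + ‖x‖ ^ 2)) * (1 + ‖x‖ ^ 2) := by gcongr
      _ = 2 * (1 + ‖x‖ ^ 2) + ‖t‖ * ‖x‖ := by field_simp
      _ ≤ (4 * ‖t‖ ^ 2 + ‖t‖ + 4) * ‖x‖ ^ 2 := by
          nlinarith [mul_nonneg ht (mul_nonneg hx (sub_nonneg.2 h)), sq_nonneg (‖t‖ * ‖x‖)]

lemma continuous_levyIntegrand_left (x : E) : Continuous fun t ↦ levyIntegrand t x := by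
  unfold levyIntegrand
  fun_prop

end LevyIntegrand

section LevyIntegrable

variable {E : Type*} [NormedAddCommGroup E] [MeasurableSpace E]

/-- The integrability condition on Lévy measures. -/
def LevyIntegrable (ν : Measure E) : Prop :=
  ∫⁻ x, ENNReal.ofReal (‖x‖ ^ 2 / (1 + ‖x‖ ^ 2)) ∂ν < ⊤

variable {ν : Measure E} [BorelSpace E]

lemma LevyIntegrable.integrable (hν : LevyIntegrable ν) :
    Integrable (fun x ↦ ‖x‖ ^ 2 / (1 + ‖x‖ ^ 2)) ν := by
  refine ⟨Measurable.aestronglyMeasurable (by fun_prop), ?_⟩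
  rw [hasFiniteIntegral_iff_ofReal (.of_forall fun x ↦ by positivity)]
  exact hν

lemma LevyIntegrable.isFiniteMeasure_restrict (hν : LevyIntegrable ν) {ε : ℝ} (hε : 0 < ε) :
    IsFiniteMeasure (ν.restrict {x | ε < ‖x‖}) := by
  refine ⟨?_⟩
  rw [Measure.restrict_apply_univ]
  have hfin := hν.integrable.measure_norm_ge_lt_top (ε := ε ^ 2 / (1 + ε ^ 2)) (by positivity)
  refine (measure_mono fun x hx ↦ ?_).trans_lt hfin
  have hx' : ε < ‖x‖ := hx
  change _ ≤ ‖_‖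
  rw [Real.norm_of_nonneg (by positivity), div_le_div_iff₀ (by positivity) (by positivity)]
  nlinarith [pow_le_pow_left₀ hε.le hx'.le 2]

end LevyIntegrable

section CharFun
open Filter Topology

variable {E : Type*} [NormedAddCommGroup E] [InnerProductSpace ℝ E] [MeasurableSpace E]

/-- A function is a characteristic function if it is that of some probability measure. -/
def IsCharFun (f : E → ℂ) : Prop :=
  ∃ μ : Measure E, IsProbabilityMeasure μ ∧ charFun μ = f

lemma charFun_eq_integral_exp_inner (m : Measure E) (t : E) :
    charFun m t = ∫ x, Complex.exp (Complex.I * (⟪t, x⟫ : ℝ)) ∂m := by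
  simp_rw [charFun_apply, mul_comm Complex.I, real_inner_comm]

variable {ν : Measure E} [BorelSpace E]

lemma isCharFun_exp_inner (a : E) :
    IsCharFun fun t ↦ Complex.exp (Complex.I * (⟪a, t⟫ : ℝ)) :=
  ⟨Measure.dirac a, inferInstance, funext fun t ↦ by rw [charFun_dirac, mul_comm]⟩

variable [FiniteDimensional ℝ E]

lemma IsCharFun.mul {f g : E → ℂ} (hf : IsCharFun f) (hg : IsCharFun g) :
    IsCharFun (f * g) := by
  obtain ⟨μ, _, rfl⟩ := hf
  obtain ⟨ν, _, rfl⟩ := hg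
  exact ⟨μ ∗ ν, inferInstance, funext fun t ↦ charFun_conv t⟩

lemma IsCharFun.pow {f : E → ℂ} (hf : IsCharFun f) (n : ℕ) : IsCharFun (f ^ n) := by
  induction n with
  | zero => simpa [Pi.one_def] using isCharFun_exp_inner (0 : E)
  | succ n ih => exact pow_succ f n ▸ ih.mul hf

/-- A pointwise limit of characteristic functions that is continuous at `0` is a characteristic
function. -/
lemma IsCharFun.of_tendsto {f : ℕ → E → ℂ} {g : E → ℂ} (hf : ∀ n, IsCharFun (f n))
    (hg : ContinuousAt g 0) (h : ∀ t, Tendsto (fun n ↦ f n t) atTop (𝓝 (g t))) :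
    IsCharFun g := by
  choose μ hμ hμf using hf
  simp_rw [← hμf] at h
  have htight := isTightMeasureSet_of_tendsto_charFun hg h
  let ρ : ℕ → ProbabilityMeasure E := fun n ↦ ⟨μ n, hμ n⟩
  have hcomp : IsCompact (closure (Set.range ρ)) := by
    refine isCompact_closure_of_isTightMeasureSet (htight.subset ?_)
    rintro _ ⟨_, ⟨n, rfl⟩, rfl⟩
    exact ⟨n, rfl⟩
  let U : Ultrafilter ℕ := Ultrafilter.of atTop
  have hU : (U : Filter ℕ) ≤ atTop := Ultrafilter.of_le _
  obtain ⟨μ₀, -, hμ₀⟩ := hcomp.ultrafilter_le_nhds (U.map ρ) (by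
    rw [le_principal_iff]
    exact Filter.mem_map.2 (univ_mem' fun n ↦ subset_closure ⟨n, rfl⟩))
  have hlim : Tendsto ρ U (𝓝 μ₀) := hμ₀
  refine ⟨μ₀, inferInstance, funext fun t ↦ tendsto_nhds_unique ?_ ((h t).mono_left hU)⟩
  rw [ProbabilityMeasure.tendsto_iff_forall_integral_rclike_tendsto ℂ] at hlim
  simp_rw [charFun_eq_integral_innerProbChar]
  exact hlim (BoundedContinuousFunction.innerProbChar t)

lemma charFun_integrand_integrable (m : Measure E) [IsFiniteMeasure m] (t : E) :
    Integrable (fun x ↦ Complex.exp (Complex.I * (⟪t, x⟫ : ℝ))) m := by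
  refine (integrable_const (1 : ℝ)).mono (by fun_prop) (.of_forall fun x ↦ ?_)
  simp [mul_comm Complex.I, Complex.norm_exp_ofReal_mul_I]

/-- The compound Poisson characteristic function of a finite jump measure. -/
lemma isCharFun_exp_compoundPoisson (m : Measure E) [IsFiniteMeasure m] :
    IsCharFun fun t ↦ Complex.exp
      (∫ x, (Complex.exp (Complex.I * (⟪t, x⟫ : ℝ)) - 1) ∂m) := by
  have hint (t : E) : ∫ x, (Complex.exp (Complex.I * (⟪t, x⟫ : ℝ)) - 1) ∂m
      = charFun m t - m.real Set.univ := by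
    rw [integral_sub (charFun_integrand_integrable m t) (integrable_const _),
      charFun_eq_integral_exp_inner]
    simp
  simp_rw [hint]
  obtain ⟨K, hK⟩ := exists_nat_gt (m.real Set.univ)
  have hKpos (n : ℕ) : 0 < ((n + K : ℕ) : ℝ) := by
    have : (0 : ℝ) < K := measureReal_nonneg.trans_lt hK
    push_cast; positivity
  have hle (n : ℕ) : m.real Set.univ / (n + K : ℕ) ≤ 1 := by
    rw [div_le_one (hKpos n)]
    push_cast
    have : (0 : ℝ) ≤ n := n.cast_nonneg
    linarith
  refine IsCharFun.of_tendsto (f := fun n t ↦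
    (1 + (charFun m t - m.real Set.univ) / (n + K : ℕ)) ^ (n + K)) (fun n ↦ ?_) ?_ fun t ↦
      (Complex.tendsto_one_add_div_pow_exp _).comp (tendsto_add_atTop_nat K)
  · refine IsCharFun.pow (f := fun t ↦ 1 + (charFun m t - m.real Set.univ) / (n + K : ℕ))
      ⟨ENNReal.ofReal (1 - m.real Set.univ / (n + K : ℕ)) • Measure.dirac 0
        + ENNReal.ofReal (1 / (n + K : ℕ)) • m, ⟨?_⟩, funext fun t ↦ ?_⟩ _
    · simp only [Measure.coe_add, Measure.coe_smul, Pi.add_apply, Pi.smul_apply, measure_univ,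
        smul_eq_mul, mul_one]
      rw [← ofReal_measureReal (μ := m) (s := Set.univ),
        ← ENNReal.ofReal_mul (by positivity), ← ENNReal.ofReal_add (by linarith [hle n])
          (by positivity)]
      rw [ENNReal.ofReal_eq_one]
      ring
    · have h0 := (hKpos n).ne'
      rw [charFun_apply, integral_add_measure, integral_smul_measure, integral_smul_measure,
        ← charFun_apply, ← charFun_apply, charFun_dirac, ENNReal.toReal_ofReal (by linarith [hle n]),
        ENNReal.toReal_ofReal (by positivity)]
      · simp only [inner_zero_left, Complex.real_smul]
        push_cast
        simp
        ring
      all_goals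
        refine Integrable.smul_measure ?_ ENNReal.ofReal_ne_top
        simpa [mul_comm Complex.I, real_inner_comm] using charFun_integrand_integrable _ t
  · exact (Complex.continuous_exp.comp (continuous_charFun.sub continuous_const)).continuousAt


lemma measurable_levyIntegrand (t : E) : Measurable (levyIntegrand t) := by
  unfold levyIntegrand
  fun_prop

lemma LevyIntegrable.integrable_levyIntegrand (hν : LevyIntegrable ν) (t : E) :
    Integrable (levyIntegrand t) ν :=
  (hν.integrable.const_mul _).mono' (measurable_levyIntegrand t).aestronglyMeasurable
    (.of_forall (norm_levyIntegrand_le t))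

lemma LevyIntegrable.continuousAt_integral (hν : LevyIntegrable ν) :
    ContinuousAt (fun t ↦ ∫ x, levyIntegrand t x ∂ν) 0 := by
  refine continuousAt_of_dominated (bound := fun x ↦ 9 * (‖x‖ ^ 2 / (1 + ‖x‖ ^ 2)))
    (.of_forall fun t ↦ (measurable_levyIntegrand t).aestronglyMeasurable) ?_
    (hν.integrable.const_mul _) (.of_forall fun x ↦ (continuous_levyIntegrand_left x).continuousAt)
  filter_upwards [Metric.ball_mem_nhds (0 : E) one_pos] with t ht
  have ht' : ‖t‖ < 1 := by simpa using ht
  refine .of_forall fun x ↦ (norm_levyIntegrand_le t x).trans ?_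
  gcongr
  nlinarith [norm_nonneg t]

/-- The characteristic function of the compensated jump part, for a finite jump measure. -/
lemma isCharFun_exp_integral_levyIntegrand_of_finite (m : Measure E) [IsFiniteMeasure m] :
    IsCharFun fun t ↦ Complex.exp (∫ x, levyIntegrand t x ∂m) := by
  have hdrift : Integrable (fun x : E ↦ (1 + ‖x‖ ^ 2)⁻¹ • x) m := by
    refine (integrable_const (1 : ℝ)).mono (by fun_prop) (.of_forall fun x ↦ ?_)
    rw [norm_smul, norm_inv, Real.norm_of_nonneg (by positivity), norm_one,
      inv_mul_le_one₀ (by positivity)]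
    nlinarith [norm_nonneg x]
  convert! (isCharFun_exp_compoundPoisson m).mul
    (isCharFun_exp_inner (-∫ x, (1 + ‖x‖ ^ 2)⁻¹ • x ∂m)) using 1
  funext t
  rw [Pi.mul_apply, ← Complex.exp_add]
  congr 1
  have hin : ⟪-∫ x, (1 + ‖x‖ ^ 2)⁻¹ • x ∂m, t⟫ = -∫ x, ⟪t, x⟫ / (1 + ‖x‖ ^ 2) ∂m := by
    rw [inner_neg_left, real_inner_comm, ← integral_inner hdrift]
    simp_rw [real_inner_smul_right, div_eq_inv_mul]
  have hterm : Integrable (fun x ↦ ⟪t, x⟫ / (1 + ‖x‖ ^ 2)) m := by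
    simpa only [real_inner_smul_right, div_eq_inv_mul] using hdrift.const_inner (𝕜 := ℝ) t
  rw [hin, Complex.ofReal_neg, ← integral_complex_ofReal, mul_neg, ← sub_eq_add_neg,
    ← integral_const_mul, ← integral_sub]
  · refine integral_congr_ae (.of_forall fun x ↦ ?_)
    simp only [levyIntegrand]
    push_cast
    ring
  · exact (charFun_integrand_integrable m t).sub (integrable_const _)
  · exact hterm.ofReal.const_mul _

/-- The characteristic function of the compensated jump part of a Lévy measure. -/
lemma LevyIntegrable.isCharFun_exp_integral (hν : LevyIntegrable ν) :
    IsCharFun fun t ↦ Complex.exp (∫ x, levyIntegrand t x ∂ν) := by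
  refine IsCharFun.of_tendsto (f := fun (n : ℕ) t ↦ Complex.exp
    (∫ x, levyIntegrand t x ∂(ν.restrict {x | 1 / ((n : ℝ) + 1) < ‖x‖}))) (fun n ↦ ?_)
    (Complex.continuous_exp.continuousAt.comp hν.continuousAt_integral) fun t ↦ ?_
  · have := hν.isFiniteMeasure_restrict (ε := 1 / ((n : ℝ) + 1)) (by positivity)
    exact isCharFun_exp_integral_levyIntegrand_of_finite _
  · refine (Complex.continuous_exp.tendsto _).comp ?_
    have hmeas (n : ℕ) : MeasurableSet {x : E | 1 / ((n : ℝ) + 1) < ‖x‖} :=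
      measurableSet_lt measurable_const measurable_norm
    simp_rw [← integral_indicator (hmeas _)]
    refine tendsto_integral_of_dominated_convergence (fun x ↦ ‖levyIntegrand t x‖)
      (fun n ↦ ((measurable_levyIntegrand t).indicator (hmeas n)).aestronglyMeasurable)
      (hν.integrable_levyIntegrand t).norm
      (fun n ↦ .of_forall fun x ↦ norm_indicator_le_norm_self _ _) (.of_forall fun x ↦ ?_)
    refine tendsto_const_nhds.congr' ?_
    rcases eq_or_ne x 0 with rfl | hx
    · refine .of_forall fun n ↦ ?_
      simp [Set.indicator, levyIntegrand]
    · filter_upwards [tendsto_one_div_add_atTop_nhds_zero_nat.eventually_lt_const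
        (norm_pos_iff.2 hx)] with n hn
      exact (Set.indicator_of_mem (s := {x : E | 1 / ((n : ℝ) + 1) < ‖x‖}) hn _).symm

end CharFun

/-- The Lévy–Khintchine exponent with drift `a`, Gaussian covariance `A` and Lévy measure `ν`. -/
noncomputable def levyExponent {p : ℕ} (a : EuclideanSpace ℝ (Fin p))
    (A : Matrix (Fin p) (Fin p) ℝ) (ν : Measure (EuclideanSpace ℝ (Fin p)))
    (t : EuclideanSpace ℝ (Fin p)) : ℂ :=
  Complex.I * ((⟪a, t⟫ : ℝ) : ℂ) - ((∑ i, ∑ j, A i j * t i * t j : ℝ) : ℂ) / 2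
    + ∫ x, levyIntegrand t x ∂ν

lemma isCharFun_exp_levyExponent {p : ℕ} (a : EuclideanSpace ℝ (Fin p))
    {A : Matrix (Fin p) (Fin p) ℝ} (hA : A.PosSemidef)
    {ν : Measure (EuclideanSpace ℝ (Fin p))} (hν : LevyIntegrable ν) :
    IsCharFun fun t ↦ Complex.exp (levyExponent a A ν t) := by
  have hgauss : IsCharFun (charFun (multivariateGaussian a A)) := ⟨_, inferInstance, rfl⟩
  convert! hgauss.mul hν.isCharFun_exp_integral using 1
  funext t
  rw [Pi.mul_apply, charFun_multivariateGaussian hA, ← Complex.exp_add, levyExponent]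
  congr 3
  · rw [real_inner_comm, mul_comm]
  · congr 2
    simp only [dotProduct, Matrix.mulVec, Finset.mul_sum]
    refine Finset.sum_congr rfl fun i _ ↦ Finset.sum_congr rfl fun j _ ↦ by ring

lemma levyExponent_smul {p : ℕ} (a : EuclideanSpace ℝ (Fin p)) (A : Matrix (Fin p) (Fin p) ℝ)
    (ν : Measure (EuclideanSpace ℝ (Fin p))) {c : ℝ} (hc : 0 ≤ c) (t : EuclideanSpace ℝ (Fin p)) :
    levyExponent (c • a) (c • A) (ENNReal.ofReal c • ν) t = c * levyExponent a A ν t := by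
  have hsum : ∑ i, ∑ j, (c • A) i j * t i * t j = c * ∑ i, ∑ j, A i j * t i * t j := by
    simp_rw [Finset.mul_sum, Matrix.smul_apply, smul_eq_mul, mul_assoc]
  rw [levyExponent, levyExponent, hsum, integral_smul_measure, ENNReal.toReal_ofReal hc,
    real_inner_smul_left, Complex.real_smul]
  push_cast
  ring

/-- A Lévy–Khintchine law embeds, for every `N`, as the `N`-th element of a discrete convolution
semigroup. -/
lemma exists_convolution_semigroup {p : ℕ} {μ : Measure (EuclideanSpace ℝ (Fin p))}
    [IsProbabilityMeasure μ] {a : EuclideanSpace ℝ (Fin p)}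
    {A : Matrix (Fin p) (Fin p) ℝ} (hA : A.PosSemidef)
    {ν : Measure (EuclideanSpace ℝ (Fin p))} (hν : LevyIntegrable ν)
    (hμ : ∀ t, charFun μ t = Complex.exp (levyExponent a A ν t)) {N : ℕ} (hN : N ≠ 0) :
    ∃ ρ : ℕ → Measure (EuclideanSpace ℝ (Fin p)), (∀ n, IsProbabilityMeasure (ρ n)) ∧
      ρ 0 = Measure.dirac 0 ∧ (∀ m n, ρ (m + n) = ρ m ∗ ρ n) ∧ ρ N = μ := by
  have hroot (n : ℕ) : IsCharFun fun t ↦ Complex.exp ((n / N : ℝ) * levyExponent a A ν t) := by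
    have hc : (0 : ℝ) ≤ n / N := by positivity
    simp_rw [← levyExponent_smul a A ν hc]
    refine isCharFun_exp_levyExponent _ (hA.smul hc) ?_
    rw [LevyIntegrable, lintegral_smul_measure]
    exact ENNReal.mul_lt_top ENNReal.ofReal_lt_top hν
  choose ρ hρ hchar using hroot
  refine ⟨ρ, hρ, ?_, fun m n ↦ ?_, ?_⟩
  · refine Measure.ext_of_charFun (funext fun t ↦ ?_)
    simp [hchar, charFun_dirac]
  · refine Measure.ext_of_charFun (funext fun t ↦ ?_)
    rw [charFun_conv, hchar, hchar, hchar, ← Complex.exp_add, ← add_mul]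
    push_cast
    ring_nf
  · refine Measure.ext_of_charFun (funext fun t ↦ ?_)
    have : (N : ℝ) / N = 1 := div_self (by exact_mod_cast hN)
    rw [hchar, hμ, this]
    simp

lemma zero_mem_support_dirac {E : Type*} [TopologicalSpace E] [Zero E] [MeasurableSpace E] :
    (0 : E) ∈ (Measure.dirac (0 : E)).support := by
  rw [Measure.mem_support_iff_forall]
  intro U hU
  simp [Measure.dirac_apply_of_mem (mem_of_mem_nhds hU)]

section Support

variable {E : Type*} [NormedAddCommGroup E] [MeasurableSpace E] [BorelSpace E]
  [SecondCountableTopology E]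

lemma add_mem_support_conv {μ ν : Measure E} [SFinite μ] [SFinite ν] {x y : E}
    (hx : x ∈ μ.support) (hy : y ∈ ν.support) : x + y ∈ (μ ∗ ν).support := by
  rw [Measure.mem_support_iff_forall] at *
  intro U hU
  have hpre : (fun z : E × E ↦ z.1 + z.2) ⁻¹' U ∈ nhds (x, y) :=
    (continuous_add.tendsto (x, y)) hU
  obtain ⟨V, hV, W, hW, hVW⟩ := mem_nhds_prod_iff.1 hpre
  calc 0 < μ V * ν W := ENNReal.mul_pos (hx V hV).ne' (hy W hW).ne'
    _ = (μ.prod ν) (V ×ˢ W) := (Measure.prod_prod V W).symm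
    _ ≤ (μ.prod ν) ((fun z : E × E ↦ z.1 + z.2) ⁻¹' U) := measure_mono hVW
    _ ≤ (μ ∗ ν) U := Measure.le_map_apply (by fun_prop) U

variable {ρ : ℕ → Measure E} [∀ n, IsProbabilityMeasure (ρ n)]

lemma nsmul_mem_support (h0 : ρ 0 = Measure.dirac 0) (hadd : ∀ m n, ρ (m + n) = ρ m ∗ ρ n)
    {m : ℕ} {x : E} (hx : x ∈ (ρ m).support) (k : ℕ) : k • x ∈ (ρ (k * m)).support := by
  induction k with
  | zero => simpa [h0] using zero_mem_support_dirac
  | succ k ih =>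
    rw [succ_nsmul, add_mul, one_mul, hadd]
    exact add_mem_support_conv ih hx

/-- The combinations `k • u + (q - k) • v` all belong to the support at time `q * m`. -/
lemma nsmul_add_nsmul_mem_support (h0 : ρ 0 = Measure.dirac 0)
    (hadd : ∀ m n, ρ (m + n) = ρ m ∗ ρ n) {m k q : ℕ} {u v : E} (hu : u ∈ (ρ m).support)
    (hv : v ∈ (ρ m).support) (hk : k ≤ q) : k • u + (q - k) • v ∈ (ρ (q * m)).support := by
  have h := add_mem_support_conv (nsmul_mem_support h0 hadd hu k)
    (nsmul_mem_support h0 hadd hv (q - k))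
  rwa [← hadd, ← add_mul, Nat.add_sub_cancel' hk] at h

end Support

/-- If each of `p` constraints excludes at most one of `p + 1` candidates, then some candidate
satisfies all constraints. -/
lemma exists_forall_not_of_excludes_at_most_one {p : ℕ} {bad : Fin p → Fin (p + 1) → Prop}
    (h : ∀ q k l, bad q k → bad q l → k = l) : ∃ k, ∀ q, ¬ bad q k := by
  by_contra! hcon
  choose f hf using hcon
  have hinj : Function.Injective f := fun k l hkl ↦ h (f k) k l (hf k) (hkl ▸ hf l)
  simpa using Fintype.card_le_of_injective f hinj

section Semigroup

variable {p : ℕ} {ρ : ℕ → Measure (EuclideanSpace ℝ (Fin p))} [∀ n, IsProbabilityMeasure (ρ n)]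

/-- The time by which two support points can be separated in `k` coordinates. -/
def separationTime (p : ℕ) : ℕ → ℕ
  | 0 => 0
  | k + 1 => p * separationTime p k + 1

lemma exists_separated_pair (h0 : ρ 0 = Measure.dirac 0)
    (hadd : ∀ m n, ρ (m + n) = ρ m ∗ ρ n) (R : Finset (Fin p))
    (hR : ∀ r ∈ R, ∃ s ∈ (ρ 1).support, ∃ s' ∈ (ρ 1).support, s r ≠ s' r) :
    ∃ u ∈ (ρ (separationTime p R.card)).support, ∃ v ∈ (ρ (separationTime p R.card)).support,
      ∀ r ∈ R, u r ≠ v r := by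
  induction R using Finset.induction_on with
  | empty =>
    have hz : (0 : EuclideanSpace ℝ (Fin p)) ∈ (ρ (separationTime p 0)).support := by
      rw [separationTime, h0]
      exact zero_mem_support_dirac
    exact ⟨0, hz, 0, hz, by simp⟩
  | insert r T hrT ih =>
    obtain ⟨u, hu, v, hv, huv⟩ := ih fun q hq ↦ hR q (Finset.mem_insert_of_mem hq)
    obtain ⟨s, hs, s', hs', hss'⟩ := hR r (Finset.mem_insert_self r T)
    have hcomb (k : Fin (p + 1)) {z w : EuclideanSpace ℝ (Fin p)}
        (hz : z ∈ (ρ (separationTime p T.card)).support) (hw : w ∈ (ρ 1).support) :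
        (k : ℕ) • z + (p - k) • u + w ∈ (ρ (separationTime p (insert r T).card)).support := by
      rw [Finset.card_insert_of_notMem hrT, separationTime, hadd]
      exact add_mem_support_conv
        (nsmul_add_nsmul_mem_support h0 hadd hz hu (Nat.lt_succ_iff.1 k.2)) hw
    obtain ⟨k, hk⟩ := exists_forall_not_of_excludes_at_most_one
      (bad := fun q k ↦ q ∈ insert r T ∧ (k : ℝ) * (u q - v q) + (s q - s' q) = 0) (by
        rintro q k l ⟨hq, hk⟩ ⟨-, hl⟩
        have hd : u q - v q ≠ 0 := by
          intro hd
          rcases Finset.mem_insert.1 hq with rfl | hq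
          · exact hss' (by simpa [hd, sub_eq_zero] using hk)
          · exact huv q hq (sub_eq_zero.1 hd)
        have hkl : (k : ℝ) = (l : ℝ) := mul_right_cancel₀ hd (by linarith)
        exact Fin.ext (by exact_mod_cast hkl))
    refine ⟨_, hcomb k hu hs, _, hcomb k hv hs', fun q hq heq ↦ hk q ⟨hq, ?_⟩⟩
    simp only [PiLp.add_apply, PiLp.smul_apply, nsmul_eq_mul] at heq
    linear_combination heq

/-- If `ρ 1` has a deterministic coordinate, then so does every `ρ n`. -/
lemma ae_coord_eq (h0 : ρ 0 = Measure.dirac 0) (hadd : ∀ m n, ρ (m + n) = ρ m ∗ ρ n)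
    {r : Fin p} {c : ℝ} (h : ∀ᵐ x ∂ρ 1, x r = c) (n : ℕ) : ∀ᵐ x ∂ρ n, x r = n * c := by
  have hms (d : ℝ) : MeasurableSet {x : EuclideanSpace ℝ (Fin p) | x r = d} :=
    measurableSet_eq_fun (by fun_prop) measurable_const
  induction n with
  | zero =>
    rw [h0, ae_dirac_iff (hms _)]
    simp
  | succ n ih =>
    rw [hadd, Measure.conv, ae_map_iff (by fun_prop) (hms _)]
    refine (Measure.ae_prod_iff_ae_ae (measurable_add (hms _))).2 ?_
    filter_upwards [ih] with x hx
    filter_upwards [h] with y hy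
    rw [PiLp.add_apply, hx, hy]
    push_cast
    ring

lemma exists_ne_of_support_ne (h0 : ρ 0 = Measure.dirac 0)
    (hadd : ∀ m n, ρ (m + n) = ρ m ∗ ρ n) {N : ℕ} {r : Fin p}
    (h : ∃ s ∈ (ρ N).support, ∃ s' ∈ (ρ N).support, s r ≠ s' r) :
    ∃ s ∈ (ρ 1).support, ∃ s' ∈ (ρ 1).support, s r ≠ s' r := by
  by_contra! hcon
  obtain ⟨s, hs, s', hs', hne⟩ := h
  obtain ⟨c, hc⟩ : ∃ c : ℝ, ∀ x ∈ (ρ 1).support, x r = c := by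
    by_cases hemp : (ρ 1).support.Nonempty
    · obtain ⟨x₀, hx₀⟩ := hemp
      exact ⟨x₀ r, fun x hx ↦ hcon x hx x₀ hx₀⟩
    · exact ⟨0, fun x hx ↦ (hemp ⟨x, hx⟩).elim⟩
  have hae := ae_coord_eq h0 hadd (Filter.mem_of_superset Measure.support_mem_ae hc) N
  have hsub := Measure.support_subset_of_isClosed
    (t := {x : EuclideanSpace ℝ (Fin p) | x r = N * c})
    (isClosed_eq (by fun_prop) continuous_const) hae
  exact hne ((hsub hs).trans (hsub hs').symm)

end Semigroup

/-- A property holding almost everywhere holds on a dense subset of the support. -/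
lemma mem_closure_of_mem_support {E : Type*} [TopologicalSpace E] [MeasurableSpace E]
    {μ : Measure E} {G : Set E} {x : E} (hx : x ∈ μ.support) (hG : ∀ᵐ y ∂μ, y ∈ G) :
    x ∈ closure G :=
  Measure.support_subset_of_isClosed isClosed_closure
    (Filter.mem_of_superset hG subset_closure) hx

section Separation

open Filter Topology

variable {p : ℕ} {R : Finset (Fin p)} {Z : Fin (p + 1) → EuclideanSpace ℝ (Fin p)}

/-- If translations by `Z k` are pairwise separated in the coordinates of `R`, and the other
coordinates of the translates are nonzero constants, then every point has a translate
uniformly away from all coordinate hyperplanes. -/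
lemma exists_pos_forall_exists_le_abs {S : Set (EuclideanSpace ℝ (Fin p))} {d : Fin p → ℝ}
    (hZ : ∀ r ∈ R, ∀ k l, k ≠ l → Z k r ≠ Z l r) (hd : ∀ r ∉ R, d r ≠ 0)
    (hS : ∀ r ∉ R, ∀ k, ∀ y ∈ S, (Z k + y) r = d r) :
    ∃ δ > 0, ∀ y ∈ S, ∃ k, ∀ r, δ ≤ |(Z k + y) r| := by
  have hlt {c : ℝ} (hc : 0 < c) : ∀ᶠ δ in 𝓝[>] (0 : ℝ), δ < c :=
    eventually_nhdsWithin_of_eventually_nhds (eventually_lt_nhds hc)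
  have h1 : ∀ᶠ δ in 𝓝[>] (0 : ℝ), ∀ r k l, r ∈ R → k ≠ l → δ < |Z k r - Z l r| / 2 := by
    simp_rw [eventually_all]
    exact fun r k l hr hkl ↦ hlt (half_pos (abs_pos.2 (sub_ne_zero.2 (hZ r hr k l hkl))))
  have h2 : ∀ᶠ δ in 𝓝[>] (0 : ℝ), ∀ r, r ∉ R → δ < |d r| := by
    simp_rw [eventually_all]
    exact fun r hr ↦ hlt (abs_pos.2 (hd r hr))
  obtain ⟨δ, ⟨h1, h2⟩, hδ⟩ := ((h1.and h2).and self_mem_nhdsWithin).exists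
  refine ⟨δ, hδ, fun y hy ↦ ?_⟩
  obtain ⟨k, hk⟩ := exists_forall_not_of_excludes_at_most_one
    (bad := fun r k ↦ |(Z k + y) r| < δ) (fun r k l hk hl ↦ by
      by_contra hkl
      by_cases hr : r ∈ R
      · have h := h1 r k l hr hkl
        have habs : |Z k r - Z l r| ≤ |(Z k + y) r| + |(Z l + y) r| := by
          have heq : Z k r - Z l r = (Z k + y) r - (Z l + y) r := by
            simp only [PiLp.add_apply]
            ring
          rw [heq]
          exact abs_sub _ _
        linarith
      · rw [hS r hr k y hy] at hk
        exact (h2 r hr).not_gt hk)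
  exact ⟨k, fun r ↦ not_lt.1 (hk r)⟩

/-- Coordinatewise separation of finitely many support points survives a perturbation into a set
of full measure. -/
lemma exists_separated_mem {μ : Measure (EuclideanSpace ℝ (Fin p))}
    {G : Set (EuclideanSpace ℝ (Fin p))} (hG : ∀ᵐ z ∂μ, z ∈ G)
    (hmem : ∀ k, Z k ∈ μ.support) (hZ : ∀ r ∈ R, ∀ k l, k ≠ l → Z k r ≠ Z l r) :
    ∃ Z' : Fin (p + 1) → EuclideanSpace ℝ (Fin p), (∀ k, Z' k ∈ G) ∧
      ∀ r ∈ R, ∀ k l, k ≠ l → Z' k r ≠ Z' l r := by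
  have hcl : Z ∈ closure (Set.pi Set.univ fun _ : Fin (p + 1) ↦ G) := by
    rw [closure_pi_set]
    exact fun k _ ↦ mem_closure_of_mem_support (hmem k) hG
  have hev : ∀ᶠ W in 𝓝 Z, ∀ r k l, r ∈ R → k ≠ l → W k r ≠ W l r := by
    simp_rw [eventually_all]
    intro r k l hr hkl
    have hopen : IsOpen {W : Fin (p + 1) → EuclideanSpace ℝ (Fin p) | W k r ≠ W l r} :=
      isOpen_ne_fun (by fun_prop) (by fun_prop)
    exact hopen.mem_nhds (hZ r hr k l hkl)
  obtain ⟨Z', hZ', hmem'⟩ := mem_closure_iff_nhds.1 hcl _ hev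
  exact ⟨Z', fun k ↦ hmem' k trivial, fun r hr k l ↦ hZ' r k l hr⟩

end Separation

/-- A probability measure is infinitely divisible if for every `N ≠ 0` it is
the `N`-th element of a discrete convolution semigroup of probability measures. -/
def IsInfinitelyDivisible {p : ℕ} (μ : Measure (EuclideanSpace ℝ (Fin p))) : Prop :=
  ∀ N : ℕ, N ≠ 0 → ∃ ρ : ℕ → Measure (EuclideanSpace ℝ (Fin p)),
    (∀ n, IsProbabilityMeasure (ρ n)) ∧ ρ 0 = Measure.dirac 0 ∧
      (∀ m n, ρ (m + n) = ρ m ∗ ρ n) ∧ ρ N = μ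

/-- An infinitely divisible law decomposes as `ρ M ∗ ρ 1` in such a way that finitely many
translations by points of the support of `ρ M` move every point of the support of `ρ 1` uniformly
away from the coordinate hyperplanes. -/
lemma IsInfinitelyDivisible.exists_semigroup_translations {p : ℕ}
    {μ : Measure (EuclideanSpace ℝ (Fin p))} (hμ : IsInfinitelyDivisible μ)
    (hnz : ∀ r, ∃ x ∈ μ.support, x r ≠ 0) :
    ∃ (ρ : ℕ → Measure (EuclideanSpace ℝ (Fin p))) (M : ℕ),
      (∀ n, IsProbabilityMeasure (ρ n)) ∧ ρ 0 = Measure.dirac 0 ∧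
      (∀ m n, ρ (m + n) = ρ m ∗ ρ n) ∧ ρ (M + 1) = μ ∧
      ∀ G : Set (EuclideanSpace ℝ (Fin p)), (∀ᵐ z ∂ρ M, z ∈ G) →
        ∃ δ > 0, ∃ Z : Fin (p + 1) → EuclideanSpace ℝ (Fin p),
          (∀ k, Z k ∈ G ∩ (ρ M).support) ∧
          ∀ y ∈ (ρ 1).support, ∃ k, ∀ r, δ ≤ |(Z k + y) r| := by
  classical
  let R : Finset (Fin p) :=
    {r | ∃ s ∈ μ.support, ∃ s' ∈ μ.support, s r ≠ s' r}
  obtain ⟨ρ, hρ, h0, hadd, hN⟩ := hμ (p * separationTime p R.card + 1) (Nat.succ_ne_zero _)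
  refine ⟨ρ, p * separationTime p R.card, hρ, h0, hadd, hN, fun G hG ↦ ?_⟩
  obtain ⟨u, hu, v, hv, huv⟩ := exists_separated_pair h0 hadd R fun r hr ↦
    exists_ne_of_support_ne h0 hadd (hN ▸ (Finset.mem_filter.1 hr).2)
  obtain ⟨Z, hZG, hZ⟩ := exists_separated_mem (R := R)
    (Z := fun k : Fin (p + 1) ↦ (k : ℕ) • u + (p - k) • v)
    (hG.and Measure.support_mem_ae)
    (fun k ↦ nsmul_add_nsmul_mem_support h0 hadd hu hv (Nat.lt_succ_iff.1 k.2))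
    (fun r hr k l hkl heq ↦ hkl <| by
      simp only [PiLp.add_apply, PiLp.smul_apply, nsmul_eq_mul,
        Nat.cast_sub (Nat.lt_succ_iff.1 k.2), Nat.cast_sub (Nat.lt_succ_iff.1 l.2)] at heq
      have hkl : (k : ℝ) = (l : ℝ) :=
        mul_right_cancel₀ (sub_ne_zero.2 (huv r hr)) (by linear_combination heq)
      exact Fin.ext (by exact_mod_cast hkl))
  choose d hd hdne using hnz
  obtain ⟨δ, hδ, h⟩ := exists_pos_forall_exists_le_abs (S := (ρ 1).support)
    (d := fun r ↦ d r r) hZ (fun r _ ↦ hdne r) (fun r hr k y hy ↦ by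
      by_contra hne
      refine hr (Finset.mem_filter.2 ⟨Finset.mem_univ r, Z k + y, ?_, d r, hd r, hne⟩)
      rw [← hN, hadd]
      exact add_mem_support_conv (hZG k).2 hy)
  exact ⟨δ, hδ, Z, hZG, h⟩

/-- An infinitely divisible law none of whose coordinates vanishes identically charges the
complement of the coordinate hyperplanes. -/
lemma IsInfinitelyDivisible.exists_mem_support_forall_ne_zero {p : ℕ}
    {μ : Measure (EuclideanSpace ℝ (Fin p))} (hμ : IsInfinitelyDivisible μ)
    (hnz : ∀ r, ∃ x ∈ μ.support, x r ≠ 0) : ∃ x ∈ μ.support, ∀ r, x r ≠ 0 := by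
  obtain ⟨ρ, M, hρ, -, hadd, hN, h⟩ := hμ.exists_semigroup_translations hnz
  obtain ⟨δ, hδ, Z, hZ, hy⟩ := h Set.univ (.of_forall fun _ ↦ trivial)
  obtain ⟨y, hyρ⟩ := (Filter.nonempty_of_mem (Measure.support_mem_ae (μ := ρ 1)))
  obtain ⟨k, hk⟩ := hy y hyρ
  refine ⟨Z k + y, ?_, fun r ↦ abs_pos.1 (hδ.trans_le (hk r))⟩
  rw [← hN, hadd]
  exact add_mem_support_conv (hZ k).2 hyρ

section Moments

variable {p : ℕ} {β : Fin p → ℝ}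

/-- A submultiplicative weight dominating all the mixed moments of order at most `β`. -/
noncomputable def momentWeight (β : Fin p → ℝ) (x : EuclideanSpace ℝ (Fin p)) : ℝ :=
  ∏ r, (1 + |x r|) ^ β r

lemma momentWeight_nonneg (x : EuclideanSpace ℝ (Fin p)) : 0 ≤ momentWeight β x :=
  Finset.prod_nonneg fun _ _ ↦ by positivity

lemma measurable_momentWeight : Measurable (momentWeight β) := by
  unfold momentWeight
  fun_prop

lemma prod_abs_rpow_le_momentWeight {α : Fin p → ℝ} (hα : ∀ r, α r ∈ Set.Icc 0 (β r))
    (x : EuclideanSpace ℝ (Fin p)) : ∏ r, |x r| ^ α r ≤ momentWeight β x := by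
  refine Finset.prod_le_prod (fun _ _ ↦ by positivity) fun r _ ↦ ?_
  calc |x r| ^ α r ≤ (1 + |x r|) ^ α r :=
        Real.rpow_le_rpow (abs_nonneg _) (by linarith) (hα r).1
    _ ≤ (1 + |x r|) ^ β r :=
        Real.rpow_le_rpow_of_exponent_le (by linarith [abs_nonneg (x r)]) (hα r).2

lemma momentWeight_add_le (hβ : ∀ r, 0 ≤ β r) (x y : EuclideanSpace ℝ (Fin p)) :
    momentWeight β (x + y) ≤ momentWeight β x * momentWeight β y := by
  rw [momentWeight, momentWeight, momentWeight, ← Finset.prod_mul_distrib]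
  refine Finset.prod_le_prod (fun _ _ ↦ by positivity) fun r _ ↦ ?_
  rw [← Real.mul_rpow (by positivity) (by positivity)]
  refine Real.rpow_le_rpow (by positivity) ?_ (hβ r)
  have h := abs_add_le (x r) (y r)
  rw [PiLp.add_apply]
  nlinarith [mul_nonneg (abs_nonneg (x r)) (abs_nonneg (y r))]

lemma lintegral_momentWeight_lt_top (hβ : ∀ r, 0 ≤ β r)
    {ρ : ℕ → Measure (EuclideanSpace ℝ (Fin p))} [∀ n, IsProbabilityMeasure (ρ n)]
    (h0 : ρ 0 = Measure.dirac 0) (hadd : ∀ m n, ρ (m + n) = ρ m ∗ ρ n)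
    (h : ∫⁻ x, ENNReal.ofReal (momentWeight β x) ∂ρ 1 < ⊤) (n : ℕ) :
    ∫⁻ x, ENNReal.ofReal (momentWeight β x) ∂ρ n < ⊤ := by
  have hmeas := (measurable_momentWeight (β := β)).ennreal_ofReal
  induction n with
  | zero =>
    rw [h0, lintegral_dirac' _ hmeas]
    exact ENNReal.ofReal_lt_top
  | succ n ih =>
    rw [hadd, Measure.lintegral_conv hmeas]
    calc ∫⁻ x, ∫⁻ y, ENNReal.ofReal (momentWeight β (x + y)) ∂ρ 1 ∂ρ n
        ≤ ∫⁻ x, ∫⁻ y, ENNReal.ofReal (momentWeight β x) * ENNReal.ofReal (momentWeight β y)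
            ∂ρ 1 ∂ρ n := by
          gcongr with x y
          rw [← ENNReal.ofReal_mul (momentWeight_nonneg x)]
          exact ENNReal.ofReal_le_ofReal (momentWeight_add_le hβ x y)
      _ = (∫⁻ x, ENNReal.ofReal (momentWeight β x) ∂ρ n)
            * ∫⁻ y, ENNReal.ofReal (momentWeight β y) ∂ρ 1 := by
          simp_rw [lintegral_const_mul _ hmeas]
          rw [lintegral_mul_const _ hmeas]
      _ < ⊤ := ENNReal.mul_lt_top ih h

/-- Away from the coordinate hyperplanes, the weight is controlled by the translated moment. -/
lemma momentWeight_le_mul_prod (hβ : ∀ r, 0 ≤ β r) {δ B : ℝ} (hδ : 0 < δ)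
    {z y : EuclideanSpace ℝ (Fin p)} (hz : ∀ r, |z r| ≤ B) (hy : ∀ r, δ ≤ |(z + y) r|) :
    momentWeight β y ≤ (∏ r, ((1 + B) / δ + 1) ^ β r) * ∏ r, |(z + y) r| ^ β r := by
  rw [momentWeight, ← Finset.prod_mul_distrib]
  refine Finset.prod_le_prod (fun _ _ ↦ by positivity) fun r _ ↦ ?_
  have hB : 0 ≤ B := (abs_nonneg _).trans (hz r)
  rw [← Real.mul_rpow (by positivity) (abs_nonneg _)]
  refine Real.rpow_le_rpow (by positivity) ?_ (hβ r)
  have h1 : |y r| ≤ |(z + y) r| + |z r| := by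
    have heq : y r = (z + y) r - z r := by simp
    rw [heq]
    exact abs_sub _ _
  have h2 : 1 + B ≤ (1 + B) / δ * |(z + y) r| := by
    rw [div_mul_eq_mul_div, le_div_iff₀ hδ]
    exact mul_le_mul_of_nonneg_left (hy r) (by positivity)
  linarith [hz r]

lemma IsInfinitelyDivisible.lintegral_momentWeight_lt_top
    {μ : Measure (EuclideanSpace ℝ (Fin p))} (hμ : IsInfinitelyDivisible μ)
    (hnz : ∀ r, ∃ x ∈ μ.support, x r ≠ 0) (hβ : ∀ r, 0 ≤ β r)
    (h : ∫⁻ x, ENNReal.ofReal (∏ r, |x r| ^ β r) ∂μ < ⊤) :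
    ∫⁻ x, ENNReal.ofReal (momentWeight β x) ∂μ < ⊤ := by
  obtain ⟨ρ, M, hρ, h0, hadd, hN, htrans⟩ := hμ.exists_semigroup_translations hnz
  have hmeas : Measurable fun x : EuclideanSpace ℝ (Fin p) ↦
      ENNReal.ofReal (∏ r, |x r| ^ β r) := by fun_prop
  rw [← hN, hadd, Measure.lintegral_conv hmeas] at h
  have hae := ae_lt_top (by fun_prop) h.ne
  obtain ⟨δ, hδ, Z, hZ, hy⟩ := htrans _ hae
  rw [← hN]
  refine _root_.lintegral_momentWeight_lt_top hβ h0 hadd ?_ _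
  let B : ℝ := ∑ k, ∑ r, |Z k r|
  have hB (k : Fin (p + 1)) (r : Fin p) : |Z k r| ≤ B :=
    (Finset.single_le_sum (f := fun r ↦ |Z k r|) (fun _ _ ↦ abs_nonneg _)
      (Finset.mem_univ r)).trans (Finset.single_le_sum (f := fun k ↦ ∑ r, |Z k r|)
        (fun _ _ ↦ Finset.sum_nonneg fun _ _ ↦ abs_nonneg _) (Finset.mem_univ k))
  have hB0 : 0 ≤ B := Finset.sum_nonneg fun _ _ ↦ Finset.sum_nonneg fun _ _ ↦ abs_nonneg _
  let C : ℝ := ∏ r, ((1 + B) / δ + 1) ^ β r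
  have hC : 0 ≤ C := Finset.prod_nonneg fun _ _ ↦ by positivity
  calc ∫⁻ y, ENNReal.ofReal (momentWeight β y) ∂ρ 1
      ≤ ∫⁻ y, ENNReal.ofReal C * ∑ k, ENNReal.ofReal (∏ r, |(Z k + y) r| ^ β r) ∂ρ 1 := by
        refine lintegral_mono_ae ?_
        filter_upwards [Measure.support_mem_ae (μ := ρ 1)] with y hyρ
        obtain ⟨k, hk⟩ := hy y hyρ
        refine (ENNReal.ofReal_le_ofReal (momentWeight_le_mul_prod hβ hδ (hB k) hk)).trans ?_
        rw [ENNReal.ofReal_mul hC]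
        gcongr
        exact Finset.single_le_sum
          (f := fun k ↦ ENNReal.ofReal (∏ r, |(Z k + y) r| ^ β r)) (by simp) (Finset.mem_univ k)
    _ = ENNReal.ofReal C * ∑ k, ∫⁻ y, ENNReal.ofReal (∏ r, |(Z k + y) r| ^ β r) ∂ρ 1 := by
        rw [lintegral_const_mul _ (by fun_prop), lintegral_finsetSum _ (by fun_prop)]
    _ < ⊤ := ENNReal.mul_lt_top ENNReal.ofReal_lt_top
        (ENNReal.sum_lt_top.2 fun k _ ↦ (hZ k).1)

end Moments

/-- **Theorem 2.** Let `X = (X₁,…,X_p)` be an infinitely divisible random vector with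
Lévy–Khintchine characteristic function, let `β_r ∈ [0,∞)`, and assume `P(X_r = 0) < 1`
for each `r`.  Then `E(∏ r, |X_r|^{α_r}) < ∞` for all `α_r ∈ [0, β_r]` is equivalent to
`E(∏ r, |X_r|^{β_r}) < ∞`; moreover `P(∏ r, |X_r| > 0) > 0`. -/
theorem moments_id_equiv_max_moment
    {Ω : Type*} [MeasurableSpace Ω] (P : Measure Ω) [IsProbabilityMeasure P]
    (p : ℕ) (hp : 1 ≤ p)
    (X : Ω → EuclideanSpace ℝ (Fin p)) (hX : Measurable X)
    (a : EuclideanSpace ℝ (Fin p))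
    (A : Matrix (Fin p) (Fin p) ℝ) (hA : A.PosSemidef)
    (ν : Measure (EuclideanSpace ℝ (Fin p)))
    (hν0 : ν {0} = 0)
    (hνint : ∫⁻ x, ENNReal.ofReal (‖x‖ ^ 2 / (1 + ‖x‖ ^ 2)) ∂ν < ⊤)
    (hφ : ∀ t : EuclideanSpace ℝ (Fin p),
      ∫ ω, Complex.exp (Complex.I * ((⟪t, X ω⟫ : ℝ) : ℂ)) ∂P =
        Complex.exp (Complex.I * ((⟪a, t⟫ : ℝ) : ℂ)
          - ((∑ i, ∑ j, A i j * t i * t j : ℝ) : ℂ) / 2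
          + ∫ x, (Complex.exp (Complex.I * ((⟪t, x⟫ : ℝ) : ℂ)) - 1
              - Complex.I * ((⟪t, x⟫ : ℝ) : ℂ) / ((1 + ‖x‖ ^ 2 : ℝ) : ℂ)) ∂ν))
    (β : Fin p → ℝ) (hβ : ∀ r, 0 ≤ β r)
    (hnz : ∀ r, P {ω | X ω r = 0} < 1)
:
    ((∀ α : Fin p → ℝ, (∀ r, α r ∈ Set.Icc 0 (β r)) →
        ∫⁻ ω, ENNReal.ofReal (∏ r, |X ω r| ^ α r) ∂P < ⊤) ↔
      ∫⁻ ω, ENNReal.ofReal (∏ r, |X ω r| ^ β r) ∂P < ⊤) ∧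
    0 < P {ω | 0 < ∏ r, |X ω r|} := by
  have hmap : IsProbabilityMeasure (P.map X) := Measure.isProbabilityMeasure_map hX.aemeasurable
  have hdiv : IsInfinitelyDivisible (P.map X) := fun N hN ↦
    exists_convolution_semigroup (a := a) hA (ν := ν) hνint (fun t ↦ by
      rw [charFun_eq_integral_exp_inner, integral_map hX.aemeasurable (by fun_prop), hφ t]
      rfl) hN
  have hsupp (r : Fin p) : ∃ x ∈ (P.map X).support, x r ≠ 0 := by
    by_contra! hcon
    have hae : ∀ᵐ ω ∂P, X ω r = 0 := ae_of_ae_map hX.aemeasurable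
      (Filter.mem_of_superset Measure.support_mem_ae hcon)
    exact (hnz r).ne (prob_compl_eq_zero_iff₀ (measurableSet_eq_fun (by fun_prop)
      measurable_const).nullMeasurableSet |>.1 hae)
  refine ⟨⟨fun h ↦ h β fun r ↦ ⟨hβ r, le_rfl⟩, fun h α hα ↦ ?_⟩, ?_⟩
  · have hw := hdiv.lintegral_momentWeight_lt_top hsupp hβ
      (by rwa [lintegral_map (by fun_prop) hX])
    rw [lintegral_map measurable_momentWeight.ennreal_ofReal hX] at hw
    exact (lintegral_mono fun ω ↦ ENNReal.ofReal_le_ofReal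
      (prod_abs_rpow_le_momentWeight hα (X ω))).trans_lt hw
  · obtain ⟨x, hx, hne⟩ := hdiv.exists_mem_support_forall_ne_zero hsupp
    have hopen : IsOpen {y : EuclideanSpace ℝ (Fin p) | 0 < ∏ r, |y r|} :=
      isOpen_lt continuous_const (by fun_prop)
    have hpos := (Measure.mem_support_iff_forall x).1 hx _
      (hopen.mem_nhds (Finset.prod_pos fun r _ ↦ abs_pos.2 (hne r)))
    rwa [Measure.map_apply hX hopen.measurableSet] at hpos
end
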